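/- arXiv:2208.06546 — 9 statements merged into one kernel-verified Lean document; each statement's English description precedes it below -/
import Mathlib

section
/- Let θ > 1 and α > 0. Set t_k = θ^k for k ∈ ℕ, and define a : [1, ∞) → ℝ by a(t) = α for t ∈ [t_{2k-1}, t_{2k}) (k ≥ 1) and a(t) = −α for t ∈ [t_{2k}, t_{2k+1}) (k ≥ 0). Then limsup_{t→∞} (1/t) ∫_1^t a(τ) dτ = ((θ−1)/(θ+1)) α. -/
open Filter Set

/-- On an interval `[s, t)` where `a` is constant, `a` is integrable with the expected integral. -/
lemma intervalIntegrable_and_integral_of_const_on_Ico {a : ℝ → ℝ} {s t c : ℝ} (hst : s ≤ t)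
    (h : ∀ x ∈ Set.Ico s t, a x = c) :
    IntervalIntegrable a MeasureTheory.volume s t ∧ ∫ x in s..t, a x = c * (t - s) := by
  have hae : ∀ᵐ x ∂MeasureTheory.volume, x ∈ Set.uIoc s t → c = a x := by
    have hne : ∀ᵐ x : ℝ ∂MeasureTheory.volume, x ≠ t := by
      simp [MeasureTheory.ae_iff]
    filter_upwards [hne] with x hx hmem
    rw [Set.uIoc_of_le hst] at hmem
    exact (h x ⟨hmem.1.le, lt_of_le_of_ne hmem.2 hx⟩).symm
  constructor
  · refine (intervalIntegrable_const (c := c)).congr_ae ?_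
    exact (MeasureTheory.ae_restrict_iff' measurableSet_uIoc).2 hae
  · rw [← intervalIntegral.integral_congr_ae hae]
    simp [mul_comm]

section AlternatingDrift

variable {θ α : ℝ} {a : ℝ → ℝ}

/-- The integral of the alternating drift up to a breakpoint. -/
lemma intervalIntegrable_and_integral_alternating_pow (hθ : 1 < θ)
    (h : ∀ n : ℕ, ∀ t ∈ Set.Ico (θ ^ n) (θ ^ (n + 1)), a t = (-1) ^ (n + 1) * α) (n : ℕ) :
    IntervalIntegrable a MeasureTheory.volume 1 (θ ^ n) ∧
      ∫ τ in (1 : ℝ)..θ ^ n, a τ = (θ - 1) / (θ + 1) * α * ((-1) ^ n * θ ^ n - 1) := by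
  induction n with
  | zero => simp
  | succ n ih =>
    obtain ⟨hi, hv⟩ := intervalIntegrable_and_integral_of_const_on_Ico
      (pow_le_pow_right₀ hθ.le (Nat.le_add_right n 1)) (h n)
    refine ⟨ih.1.trans hi, ?_⟩
    rw [← intervalIntegral.integral_add_adjacent_intervals ih.1 hi, ih.2, hv]
    have : θ + 1 ≠ 0 := by linarith
    field_simp
    ring

/-- The integral of the alternating drift up to an arbitrary time. -/
lemma integral_alternating (hθ : 1 < θ)
    (h : ∀ n : ℕ, ∀ t ∈ Set.Ico (θ ^ n) (θ ^ (n + 1)), a t = (-1) ^ (n + 1) * α) {n : ℕ} {t : ℝ}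
    (h1 : θ ^ n ≤ t) (h2 : t ≤ θ ^ (n + 1)) :
    ∫ τ in (1 : ℝ)..t, a τ =
      (θ - 1) / (θ + 1) * α * ((-1) ^ n * θ ^ n - 1) + (-1) ^ (n + 1) * α * (t - θ ^ n) := by
  obtain ⟨hi, hv⟩ := intervalIntegrable_and_integral_of_const_on_Ico h1
    (fun x hx => h n x ⟨hx.1, hx.2.trans_le h2⟩)
  obtain ⟨hi', hv'⟩ := intervalIntegrable_and_integral_alternating_pow hθ h n
  rw [← intervalIntegral.integral_add_adjacent_intervals hi' hi, hv', hv]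

lemma integral_alternating_le (hθ : 1 < θ) (hα : 0 < α)
    (h : ∀ n : ℕ, ∀ t ∈ Set.Ico (θ ^ n) (θ ^ (n + 1)), a t = (-1) ^ (n + 1) * α) {t : ℝ}
    (ht : 1 ≤ t) :
    ∫ τ in (1 : ℝ)..t, a τ ≤ (θ - 1) / (θ + 1) * α * t := by
  obtain ⟨n, h1, h2⟩ := exists_nat_pow_near ht hθ
  rw [integral_alternating hθ h h1 h2.le]
  set c := (θ - 1) / (θ + 1) with hc
  have hc0 : 0 < c := div_pos (by linarith) (by linarith)
  have hc1 : c < 1 := (div_lt_one (by linarith)).2 (by linarith)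
  have hcθ : c * (θ + 1) = θ - 1 := div_mul_cancel₀ _ (by linarith)
  have hcα : 0 < c * α := mul_pos hc0 hα
  rcases n.even_or_odd with hn | hn
  · rw [hn.neg_one_pow, hn.add_one.neg_one_pow]
    nlinarith [mul_nonneg hcα.le (sub_nonneg.2 h1), mul_nonneg hα.le (sub_nonneg.2 h1)]
  · rw [hn.neg_one_pow, hn.add_one.neg_one_pow]
    have key : c * α * (-1 * θ ^ n - 1) + 1 * α * (t - θ ^ n) =
        c * α * t - (1 - c) * α * (θ ^ (n + 1) - t) - c * α := by
      rw [pow_succ]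
      linear_combination (-α * θ ^ n) * hcθ
    rw [key]
    have := mul_nonneg (mul_nonneg (sub_nonneg.2 hc1.le) hα.le) (sub_nonneg.2 h2.le)
    linarith

end AlternatingDrift

/-- A drift coefficient alternating between `α` on `[θ^(2k-1), θ^(2k))` and `-α` on
`[θ^(2k), θ^(2k+1))` has average growth rate `((θ-1)/(θ+1)) * α`. -/
theorem stmt0 (θ α : ℝ) (hθ : 1 < θ) (hα : 0 < α)
    (a : ℝ → ℝ)
    (ha1 : ∀ k : ℕ, 1 ≤ k → ∀ t ∈ Set.Ico (θ ^ (2 * k - 1)) (θ ^ (2 * k)), a t = α)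
    (ha2 : ∀ k : ℕ, ∀ t ∈ Set.Ico (θ ^ (2 * k)) (θ ^ (2 * k + 1)), a t = -α) :
    Filter.limsup (fun t : ℝ => (1 / t) * ∫ τ in (1:ℝ)..t, a τ) Filter.atTop
      = ((θ - 1) / (θ + 1)) * α := by
  have h : ∀ n : ℕ, ∀ t ∈ Set.Ico (θ ^ n) (θ ^ (n + 1)), a t = (-1) ^ (n + 1) * α := by
    intro n t ht
    rcases n.even_or_odd' with ⟨k, rfl | rfl⟩
    · rw [ha2 k t ht, (even_two_mul k).add_one.neg_one_pow, neg_one_mul]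
    · rw [ha1 (k + 1) (by omega) t ht]
      simp [pow_succ, pow_mul]
  have hle : ∀ᶠ t : ℝ in atTop,
      (1 / t) * ∫ τ in (1:ℝ)..t, a τ ≤ ((θ - 1) / (θ + 1)) * α := by
    filter_upwards [eventually_ge_atTop 1] with t ht
    rw [one_div_mul_eq_div, div_le_iff₀ (by linarith)]
    exact integral_alternating_le hθ hα h ht
  have htop : Tendsto (fun k : ℕ => θ ^ (2 * k)) atTop atTop :=
    (tendsto_pow_atTop_atTop_of_one_lt hθ).comp
      (tendsto_id.const_mul_atTop' (by norm_num))
  have hlim : Tendsto (fun k : ℕ => (1 / θ ^ (2 * k)) * ∫ τ in (1:ℝ)..θ ^ (2 * k), a τ) atTop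
      (nhds ((θ - 1) / (θ + 1) * α)) := by
    have h0 : Tendsto (fun k : ℕ => (θ - 1) / (θ + 1) * α * (1 - (θ ^ (2 * k))⁻¹)) atTop
        (nhds ((θ - 1) / (θ + 1) * α * (1 - 0))) :=
      (tendsto_const_nhds.sub htop.inv_tendsto_atTop).const_mul _
    rw [sub_zero, mul_one] at h0
    refine h0.congr fun k => ?_
    rw [(intervalIntegrable_and_integral_alternating_pow hθ h (2 * k)).2,
      (even_two_mul k).neg_one_pow]
    have : θ ^ (2 * k) ≠ 0 := pow_ne_zero _ (by linarith)
    have : θ + 1 ≠ 0 := by linarith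
    field_simp
  have hfreq : ∀ b < (θ - 1) / (θ + 1) * α,
      ∃ᶠ t : ℝ in atTop, b ≤ (1 / t) * ∫ τ in (1:ℝ)..t, a τ := fun b hb =>
    htop.frequently (hlim.eventually_const_le hb).frequently
  refine le_antisymm (limsup_le_of_le ?_ hle) (le_of_forall_lt_imp_le_of_dense fun b hb => ?_)
  · exact IsCoboundedUnder.of_frequently_ge (hfreq _ (sub_one_lt _))
  · exact le_limsup_of_frequently_le (hfreq b hb) (isBoundedUnder_of_eventually_le hle)
end

section
/- Let θ > 1, let λ₂ ≥ λ₁ > 0, and let β > 0. Set α_i = ((θ+1)/(θ−1))(λ_i + β²/2) for i = 1, 2, set t_k = θ^k, and define a₁, a₂ : [1, ∞) → ℝ by: a₁(t) = α₁ and a₂(t) = −α₂ for t ∈ [t_{2k−1}, t_{2k}), and a₁(t) = −α₁ and a₂(t) = α₂ for t ∈ [t_{2k}, t_{2k+1}). Let w : [1, ∞) → ℝ satisfy lim_{t→∞} w(t)/t = 0. Then the functions X_i(t) = exp( ∫_1^t a_i(τ) dτ − (β²/2)(t − 1) + β(w(t) − w(1)) ), i = 1, 2, satisfy limsup_{t→∞}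 (1/t) ln X_i(t) = λ_i. -/
open Filter Set

/-- A function that is eventually at most `h`, frequently at least `h`, where `h` tends to `L`,
has limsup `L`. -/
lemma limsup_eq_of_eventually_le_of_frequently_ge {ι : Type*} {l : Filter ι} {g h : ι → ℝ} {L : ℝ}
    (hh : Tendsto h l (nhds L)) (hle : ∀ᶠ t in l, g t ≤ h t) (hge : ∃ᶠ t in l, h t ≤ g t) :
    limsup g l = L := by
  have upper : ∀ ε > 0, ∀ᶠ t in l, g t ≤ L + ε := fun ε hε => by
    filter_upwards [hle, hh.eventually_le_const (show L < L + ε by linarith)] with t h₁ h₂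
    exact h₁.trans h₂
  have lower : ∀ ε > 0, ∃ᶠ t in l, L - ε ≤ g t := fun ε hε =>
    (hge.and_eventually (hh.eventually_const_le (show L - ε < L by linarith))).mono
      fun t ht => ht.2.trans ht.1
  apply le_antisymm
  · exact le_of_forall_pos_le_add fun ε hε =>
      limsup_le_of_le (IsCoboundedUnder.of_frequently_ge (lower 1 one_pos)) (upper ε hε)
  · refine le_of_forall_pos_le_add fun ε hε => ?_
    have := le_limsup_of_frequently_le (lower ε hε) ⟨L + 1, upper 1 one_pos⟩
    linarith

/-- The primitive of a step function alternating in sign on the geometric intervals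
`[θ ^ n, θ ^ (n + 1))`. -/
lemma integral_alternating_geometric {θ d : ℝ} {a : ℝ → ℝ} (hθ : 1 < θ)
    (ha : ∀ n : ℕ, ∀ t ∈ Ico (θ ^ n) (θ ^ (n + 1)),
      a t = (-1) ^ n * ((θ + 1) / (θ - 1) * d)) (n : ℕ) :
    ∀ t ∈ Icc (θ ^ n) (θ ^ (n + 1)), IntervalIntegrable a MeasureTheory.volume 1 t ∧
      ∫ τ in (1:ℝ)..t, a τ =
        d + (-1) ^ n * d * ((θ + 1) / (θ - 1) * (t - θ ^ n) - θ ^ n) := by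
  have piece : ∀ n : ℕ, ∀ t ∈ Icc (θ ^ n) (θ ^ (n + 1)),
      IntervalIntegrable a MeasureTheory.volume (θ ^ n) t ∧
      ∫ τ in (θ ^ n)..t, a τ = (t - θ ^ n) * ((-1) ^ n * ((θ + 1) / (θ - 1) * d)) := by
    intro n t ht
    have heq : EqOn (fun _ => (-1) ^ n * ((θ + 1) / (θ - 1) * d)) a (uIoo (θ ^ n) t) := by
      rw [uIoo_of_le ht.1]
      exact fun x hx => (ha n x ⟨hx.1.le, hx.2.trans_le ht.2⟩).symm
    refine ⟨intervalIntegrable_const.congr_uIoo heq, ?_⟩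
    rw [← intervalIntegral.integral_congr_uIoo heq, intervalIntegral.integral_const, smul_eq_mul]
  have hθ' : θ - 1 ≠ 0 := by linarith
  have start : IntervalIntegrable a MeasureTheory.volume 1 (θ ^ n) ∧
      ∫ τ in (1:ℝ)..(θ ^ n), a τ = d - (-1) ^ n * d * θ ^ n := by
    induction n with
    | zero => simp
    | succ n ih =>
      obtain ⟨hi, hv⟩ := piece n (θ ^ (n + 1)) ⟨pow_le_pow_right₀ hθ.le n.le_succ, le_rfl⟩
      refine ⟨ih.1.trans hi, ?_⟩
      rw [← intervalIntegral.integral_add_adjacent_intervals ih.1 hi, ih.2, hv]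
      field_simp
      ring
  intro t ht
  obtain ⟨hi, hv⟩ := piece n t ht
  refine ⟨start.1.trans hi, ?_⟩
  rw [← intervalIntegral.integral_add_adjacent_intervals start.1 hi, start.2, hv]
  ring

lemma integral_alternating_geometric_le {θ d : ℝ} {a : ℝ → ℝ} (hθ : 1 < θ)
    (ha : ∀ n : ℕ, ∀ t ∈ Ico (θ ^ n) (θ ^ (n + 1)),
      a t = (-1) ^ n * ((θ + 1) / (θ - 1) * d)) {t : ℝ} (ht : 1 ≤ t) :
    ∫ τ in (1:ℝ)..t, a τ ≤ d + |d| * t := by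
  obtain ⟨n, hn₁, hn₂⟩ := exists_nat_pow_near ht hθ
  rw [(integral_alternating_geometric hθ ha n t ⟨hn₁, hn₂.le⟩).2]
  have hθ' : 0 < θ - 1 := by linarith
  have hq : (θ + 1) / (θ - 1) = 1 + 2 / (θ - 1) := by field_simp; ring
  have hbound : |(θ + 1) / (θ - 1) * (t - θ ^ n) - θ ^ n| ≤ t := by
    rw [abs_le, hq]
    have h₁ : 0 ≤ 2 / (θ - 1) * (t - θ ^ n) :=
      mul_nonneg (by positivity) (by linarith)
    have h₂ : 2 / (θ - 1) * (t - θ ^ n) ≤ 2 * θ ^ n := by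
      rw [div_mul_eq_mul_div, div_le_iff₀ hθ']
      rw [pow_succ] at hn₂
      nlinarith
    constructor <;> nlinarith
  refine add_le_add_right ((le_abs_self _).trans ?_) d
  rw [abs_mul, abs_mul, abs_pow, abs_neg, abs_one, one_pow, one_mul]
  exact mul_le_mul_of_nonneg_left hbound (abs_nonneg d)

lemma frequently_integral_alternating_geometric_eq {θ d : ℝ} {a : ℝ → ℝ} (hθ : 1 < θ)
    (ha : ∀ n : ℕ, ∀ t ∈ Ico (θ ^ n) (θ ^ (n + 1)),
      a t = (-1) ^ n * ((θ + 1) / (θ - 1) * d)) :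
    ∃ᶠ t in atTop, ∫ τ in (1:ℝ)..t, a τ = d + |d| * t := by
  refine (tendsto_pow_atTop_atTop_of_one_lt hθ).frequently (frequently_atTop.2 fun N => ?_)
  have key : ∃ n ≥ N, (-1) ^ n * d = -|d| := by
    rcases le_total 0 d with hd | hd
    · exact ⟨2 * N + 1, by omega, by simp [pow_succ, pow_mul, abs_of_nonneg hd]⟩
    · exact ⟨2 * N, by omega, by simp [pow_mul, abs_of_nonpos hd]⟩
  obtain ⟨n, hnN, hn⟩ := key
  refine ⟨n, hnN, ?_⟩
  rw [(integral_alternating_geometric hθ ha n _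
    ⟨le_rfl, pow_le_pow_right₀ hθ.le n.le_succ⟩).2, hn]
  ring

/-- The Lyapunov exponent of the explicit solution driven by an alternating drift and a
sublinear path. -/
lemma lyapunovExponent_alternating_geometric {θ d β : ℝ} {a w X : ℝ → ℝ} (hθ : 1 < θ)
    (ha : ∀ n : ℕ, ∀ t ∈ Ico (θ ^ n) (θ ^ (n + 1)),
      a t = (-1) ^ n * ((θ + 1) / (θ - 1) * d))
    (hw : Tendsto (fun t => w t / t) atTop (nhds 0))
    (hX : ∀ t, X t =
      Real.exp ((∫ τ in (1:ℝ)..t, a τ) - β ^ 2 / 2 * (t - 1) + β * (w t - w 1))) :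
    limsup (fun t : ℝ => (1 / t) * Real.log (X t)) atTop = |d| - β ^ 2 / 2 := by
  simp only [hX, Real.log_exp]
  refine limsup_eq_of_eventually_le_of_frequently_ge
    (h := fun t => 1 / t * (d + |d| * t - β ^ 2 / 2 * (t - 1) + β * (w t - w 1))) ?_ ?_ ?_
  · have hinv : Tendsto (fun t : ℝ => (d + β ^ 2 / 2 - β * w 1) * t⁻¹) atTop (nhds 0) := by
      simpa only [mul_zero] using
        (tendsto_inv_atTop_zero (𝕜 := ℝ)).const_mul (d + β ^ 2 / 2 - β * w 1)
    have hlim := ((hw.const_mul β).add hinv).const_add (|d| - β ^ 2 / 2)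
    simp only [mul_zero, add_zero] at hlim
    refine hlim.congr' ?_
    filter_upwards [eventually_gt_atTop 0] with t ht
    field_simp
    ring
  · filter_upwards [eventually_ge_atTop 1] with t ht
    have := integral_alternating_geometric_le hθ ha ht
    gcongr
  · exact (frequently_integral_alternating_geometric_eq hθ ha).mono fun t ht => by rw [ht]

/-- The explicit pathwise solutions of the diagonal linear SDE with alternating drifts
`±α_i` and constant diffusion `β` have Lyapunov exponents `λ₁, λ₂`, for any sublinear
path `w`. -/
theorem stmt1 (θ lam1 lam2 β : ℝ) (hθ : 1 < θ) (hlam1 : 0 < lam1) (hlam12 : lam1 ≤ lam2)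
    (hβ : 0 < β) (α₁ α₂ : ℝ)
    (hα₁ : α₁ = (θ + 1) / (θ - 1) * (lam1 + β ^ 2 / 2))
    (hα₂ : α₂ = (θ + 1) / (θ - 1) * (lam2 + β ^ 2 / 2))
    (a₁ a₂ : ℝ → ℝ)
    (ha1 : ∀ k : ℕ, 1 ≤ k → ∀ t ∈ Set.Ico (θ ^ (2 * k - 1)) (θ ^ (2 * k)),
      a₁ t = α₁ ∧ a₂ t = -α₂)
    (ha2 : ∀ k : ℕ, ∀ t ∈ Set.Ico (θ ^ (2 * k)) (θ ^ (2 * k + 1)),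
      a₁ t = -α₁ ∧ a₂ t = α₂)
    (w : ℝ → ℝ) (hw : Filter.Tendsto (fun t => w t / t) Filter.atTop (nhds 0))
    (X₁ X₂ : ℝ → ℝ)
    (hX₁ : ∀ t, X₁ t =
      Real.exp ((∫ τ in (1:ℝ)..t, a₁ τ) - β ^ 2 / 2 * (t - 1) + β * (w t - w 1)))
    (hX₂ : ∀ t, X₂ t =
      Real.exp ((∫ τ in (1:ℝ)..t, a₂ τ) - β ^ 2 / 2 * (t - 1) + β * (w t - w 1))) :
    Filter.limsup (fun t : ℝ => (1 / t) * Real.log (X₁ t)) Filter.atTop = lam1 ∧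
    Filter.limsup (fun t : ℝ => (1 / t) * Real.log (X₂ t)) Filter.atTop = lam2 := by
  have hodd : ∀ m : ℕ, ∀ t ∈ Ico (θ ^ (2 * m + 1)) (θ ^ (2 * m + 1 + 1)),
      a₁ t = α₁ ∧ a₂ t = -α₂ := fun m => ha1 (m + 1) (by omega)
  constructor
  · rw [lyapunovExponent_alternating_geometric (d := -(lam1 + β ^ 2 / 2)) hθ ?_ hw hX₁]
    · rw [abs_neg, abs_of_pos (by positivity), add_sub_cancel_right]
    · intro n t ht
      obtain ⟨m, rfl | rfl⟩ := n.even_or_odd'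
      · simp only [(ha2 m t ht).1, hα₁, pow_mul, neg_one_sq, one_pow]
        ring
      · rw [(hodd m t ht).1, hα₁, pow_succ (-1 : ℝ), pow_mul, neg_one_sq, one_pow]
        ring
  · have hlam2 : 0 < lam2 := hlam1.trans_le hlam12
    rw [lyapunovExponent_alternating_geometric (d := lam2 + β ^ 2 / 2) hθ ?_ hw hX₂]
    · rw [abs_of_pos (by positivity), add_sub_cancel_right]
    · intro n t ht
      obtain ⟨m, rfl | rfl⟩ := n.even_or_odd'
      · simp [(ha2 m t ht).2, hα₂, pow_mul]
      · simp [(hodd m t ht).2, hα₂, pow_succ, pow_mul]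
end

section
/- Let θ > 1, s > 0, T = θs, and let α₁, β, η, ξ₁, ξ₂ be real numbers satisfying ξ₂ − η + (θ−1)(α₁ − β²/2) ≤ θ ξ₂ and ξ₁ − η + (θ−1)(α₁ − β²/2) ≥ θ ξ₁. Let w : [s, T] → ℝ be any function. Suppose x₂(s) > 0 satisfies e^{ξ₁ s + β w(s)} ≤ x₂(s) ≤ e^{ξ₂ s + β w(s)}, set x₁(s) = x₂(s) e^{−η s}, and define x₁(T) = x₁(s) e^{(α₁ − β²/2)(T−s) + β(w(T) − w(s))}. Then ξ₁ + β w(T)/T ≤ (1/T) ln x₁(T) ≤ ξ₂ + β w(T)/T. -/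
/-- Two-sided growth estimate for the expanding component over one geometric time interval
`[s, θs]`, starting from the angle condition `x₁(s) = x₂(s) e^{-ηs}`. -/
theorem stmt7 (θ s T α₁ β η ξ₁ ξ₂ : ℝ) (hθ : 1 < θ) (hs : 0 < s) (hT : T = θ * s)
    (hup : ξ₂ - η + (θ - 1) * (α₁ - β ^ 2 / 2) ≤ θ * ξ₂)
    (hlow : θ * ξ₁ ≤ ξ₁ - η + (θ - 1) * (α₁ - β ^ 2 / 2))
    (w : ℝ → ℝ)
    (x₂s x₁s x₁T : ℝ) (hx₂ : 0 < x₂s)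
    (hx₂low : Real.exp (ξ₁ * s + β * w s) ≤ x₂s)
    (hx₂up : x₂s ≤ Real.exp (ξ₂ * s + β * w s))
    (hx₁s : x₁s = x₂s * Real.exp (-η * s))
    (hx₁T : x₁T = x₁s * Real.exp ((α₁ - β ^ 2 / 2) * (T - s) + β * (w T - w s))) :
    ξ₁ + β * w T / T ≤ (1 / T) * Real.log x₁T ∧
    (1 / T) * Real.log x₁T ≤ ξ₂ + β * w T / T := by
  have hTpos : 0 < T := hT ▸ mul_pos (by linarith) hs
  have hlog : Real.log x₁T =
      Real.log x₂s + -η * s + ((α₁ - β ^ 2 / 2) * (T - s) + β * (w T - w s)) := by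
    rw [hx₁T, hx₁s, Real.log_mul (by positivity) (Real.exp_ne_zero _),
      Real.log_mul hx₂.ne' (Real.exp_ne_zero _), Real.log_exp, Real.log_exp]
  have hloglow : ξ₁ * s + β * w s ≤ Real.log x₂s := (Real.le_log_iff_exp_le hx₂).2 hx₂low
  have hlogup : Real.log x₂s ≤ ξ₂ * s + β * w s := (Real.log_le_iff_le_exp hx₂).2 hx₂up
  have hups := mul_le_mul_of_nonneg_right hup hs.le
  have hlows := mul_le_mul_of_nonneg_right hlow hs.le
  have hsum (ξ : ℝ) : ξ + β * w T / T = (ξ * T + β * w T) / T := by field_simp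
  rw [hsum, hsum, one_div_mul_eq_div, div_le_div_iff_of_pos_right hTpos,
    div_le_div_iff_of_pos_right hTpos, hlog]
  generalize w T = b
  subst hT
  constructor <;> linarith
end

section
/- Let θ > 1 and t_k = θ^k. Let f, g : [1, ∞) → ℝ satisfy limsup_{t→∞} f(t)/t = λ₀ < 0 and limsup_{t→∞} g(t)/t < ∞. Let k : ℕ → ℕ be strictly increasing with lim_{l→∞} k(l)/k(l+1) = 0, and assume liminf_{l→∞} ( f(t_{k(l+1)}) + g(t_{k(l+1)}) ) / t_{k(l+1)} ≥ 0. Then limsup_{l→∞} (1/t_{k(l+1)}) ( g(t_{k(l+1)}) − g(t_{k(l)}) ) ≥ −λ₀ > 0. -/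
open Filter

/-- If the exponents grow fast enough that `k l / k (l + 1) → 0`, then consecutive terms of the
geometric subsequence `θ ^ k l` have ratio tending to zero. -/
theorem tendsto_pow_div_pow_succ_of_tendsto_div {θ : ℝ} (hθ : 1 < θ) {k : ℕ → ℕ}
    (hk : StrictMono k)
    (hkr : Tendsto (fun l : ℕ => (k l : ℝ) / (k (l + 1))) atTop (nhds 0)) :
    Tendsto (fun l : ℕ => θ ^ k l / θ ^ k (l + 1)) atTop (nhds 0) := by
  have hθ0 : 0 < θ := zero_lt_one.trans hθ
  have hgap : Tendsto (fun l => k (l + 1) - k l) atTop atTop := by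
    refine tendsto_atTop.2 fun N => ?_
    filter_upwards [hkr.eventually_lt_const (show (0 : ℝ) < 1 / 2 by norm_num),
      eventually_ge_atTop (2 * N)] with l hl hN
    have hpos : (0 : ℝ) < k (l + 1) := by
      exact_mod_cast (Nat.zero_le _).trans_lt (hk l.lt_succ_self)
    rw [div_lt_iff₀ hpos] at hl
    have hlt : 2 * k l < k (l + 1) := by
      have : 2 * (k l : ℝ) < k (l + 1) := by linarith
      exact_mod_cast this
    have := hk.le_apply (x := l + 1)
    omega
  refine ((tendsto_inv_atTop_zero.comp (tendsto_pow_atTop_atTop_of_one_lt hθ)).comp hgap).congr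
    fun l => ?_
  have hle := (hk l.lt_succ_self).le
  simp only [Function.comp_apply]
  rw [pow_sub₀ θ hθ0.ne' hle, mul_inv, inv_inv, div_eq_mul_inv, mul_comm]

/-- Abstract form of the Assertion: if `f(t)/t` has limsup `λ₀ < 0`, `g(t)/t` has limsup
`< ∞`, and `(f+g)/t` has nonnegative liminf along the sparse geometric subsequence
`t_{k(l)} = θ^{k(l)}`, then the increments of `g` along this subsequence have limsup at
least `-λ₀ > 0`. -/
theorem stmt11 (θ : ℝ) (hθ : 1 < θ) (f g : ℝ → ℝ) (lam0 : ℝ) (hlam0 : lam0 < 0)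
    (hf : Filter.limsup (fun t : ℝ => ((f t / t : ℝ) : EReal)) Filter.atTop
      = (lam0 : EReal))
    (hg : Filter.limsup (fun t : ℝ => ((g t / t : ℝ) : EReal)) Filter.atTop < ⊤)
    (k : ℕ → ℕ) (hk : StrictMono k)
    (hkr : Filter.Tendsto (fun l : ℕ => (k l : ℝ) / (k (l + 1))) Filter.atTop (nhds 0))
    (hliminf : (0 : EReal) ≤ Filter.liminf
      (fun l : ℕ => (((f (θ ^ k (l + 1)) + g (θ ^ k (l + 1))) / θ ^ k (l + 1) : ℝ) : EReal))
      Filter.atTop) :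
    Filter.limsup
      (fun l : ℕ => (((g (θ ^ k (l + 1)) - g (θ ^ k l)) / θ ^ k (l + 1) : ℝ) : EReal))
      Filter.atTop ≥ ((-lam0 : ℝ) : EReal) ∧ (0 : ℝ) < -lam0 := by
  refine ⟨?_, neg_pos.2 hlam0⟩
  have hθ0 : 0 < θ := zero_lt_one.trans hθ
  have htk : Tendsto (fun l => θ ^ k l) atTop atTop :=
    (tendsto_pow_atTop_atTop_of_one_lt hθ).comp hk.tendsto_atTop
  obtain ⟨C, hgC, -⟩ := EReal.lt_iff_exists_real_btwn.1 hg
  refine EReal.ge_of_forall_gt_iff_ge.1 fun b hb => ?_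
  rw [EReal.coe_lt_coe_iff] at hb
  refine le_limsup_of_frequently_le (Eventually.frequently ?_)
  set ε := (-lam0 - b) / 3 with hε
  have hε0 : 0 < ε := by linarith
  have hfε : limsup (fun t : ℝ => ((f t / t : ℝ) : EReal)) atTop < ((lam0 + ε : ℝ) : EReal) := by
    rw [hf, EReal.coe_lt_coe_iff]
    linarith
  have hsum : ((-ε : ℝ) : EReal) < liminf (fun l : ℕ =>
      (((f (θ ^ k (l + 1)) + g (θ ^ k (l + 1))) / θ ^ k (l + 1) : ℝ) : EReal)) atTop :=
    lt_of_lt_of_le (by exact_mod_cast neg_lt_zero.2 hε0) hliminf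
  have hratio : Tendsto (fun l => C * (θ ^ k l / θ ^ k (l + 1))) atTop (nhds 0) := by
    simpa using (tendsto_pow_div_pow_succ_of_tendsto_div hθ hk hkr).const_mul C
  filter_upwards [htk.eventually (eventually_lt_of_limsup_lt hgC),
    (htk.comp (tendsto_add_atTop_nat 1)).eventually (eventually_lt_of_limsup_lt hfε),
    eventually_lt_of_lt_liminf hsum, hratio.eventually_lt_const hε0] with l hgl hfl hsl hrl
  simp only [Function.comp_apply, EReal.coe_lt_coe_iff] at hgl hfl hsl
  rw [EReal.coe_le_coe_iff, sub_div]
  rw [add_div] at hsl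
  have hgr : g (θ ^ k l) / θ ^ k (l + 1) ≤ C * (θ ^ k l / θ ^ k (l + 1)) := by
    rw [← mul_div_assoc]
    gcongr
    exact ((div_lt_iff₀ (pow_pos hθ0 _)).1 hgl).le
  linarith
end

section
/- For any real numbers λ₂ ≥ λ₁ > 0, any θ > 1, and any σ with 0 < σ < (θ−1)λ₁/θ, there exist a bounded C^∞ matrix function B : [1, ∞) → Mat₂(ℝ) and a C^∞ matrix function Q : [1, ∞) → Mat₂(ℝ) with ‖Q(t)‖ ≤ C e^{−σt} for all t ≥ 1 (for some constant C > 0) such that: (i) the linear equation Y′ = B(t)Y has two linearly independent solutions with Lyapunov exponents λ₁ and λ₂; (ii) the perturbed equation Y′ = (B(t) + Q(t))Y has a nontrivial solution Y₀ whose Lyapunov exponent λ₀ satisfies λ₀ ≤ θσ/(θ−1) − ((θ+1)/(θ−1))λ₁ < 0; and (iii) every solution of the perturbed equation linearly independent of Y₀ has Lyapunov exponent ≥ −λ₀ > 0, so Y₀ is, up to scalar multiples, the unique solution with negative Lyapunov exponent. -/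
open Filter

/-- The limsup of `p + c * q` can be tuned to any prescribed value above `limsup p` by choosing
`c`, provided `q` is eventually bounded below by a positive constant. -/
theorem exists_limsup_add_mul_eq {p q : ℝ → ℝ} {a b m m' lam : ℝ}
    (hp : ∀ᶠ t in atTop, a ≤ p t ∧ p t ≤ b) (hq : ∀ᶠ t in atTop, m ≤ q t ∧ q t ≤ m')
    (hm : 0 < m) (hab : a ≤ b) (hb : b ≤ lam) :
    ∃ c : ℝ, 0 ≤ c ∧ limsup (fun t => ((p t + c * q t : ℝ) : EReal)) atTop = (lam : EReal) ∧
      lam ≤ b + c * m' := by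
  have hm' : 0 < m' := by
    obtain ⟨t, ht⟩ := hq.exists
    linarith
  have upper (c : ℝ) (hc : 0 ≤ c) : ∀ᶠ t in atTop, p t + c * q t ≤ b + c * m' := by
    filter_upwards [hp, hq] with t h1 h2
    nlinarith [mul_le_mul_of_nonneg_left h2.2 hc]
  have lower (c : ℝ) (hc : 0 ≤ c) : ∀ᶠ t in atTop, a + c * m ≤ p t + c * q t := by
    filter_upwards [hp, hq] with t h1 h2
    nlinarith [mul_le_mul_of_nonneg_left h2.1 hc]
  have bdd (c : ℝ) (hc : 0 ≤ c) : IsBoundedUnder (· ≤ ·) atTop (fun t => p t + c * q t) :=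
    isBoundedUnder_of_eventually_le (upper c hc)
  have cobdd (c : ℝ) (hc : 0 ≤ c) : IsCoboundedUnder (· ≤ ·) atTop (fun t => p t + c * q t) :=
    (isBoundedUnder_of_eventually_ge (lower c hc)).isCoboundedUnder_flip
  set G : ℝ → ℝ := fun c => limsup (fun t => p t + c * q t) atTop with hG
  have hG_le (c : ℝ) (hc : 0 ≤ c) : G c ≤ b + c * m' := limsup_le_of_le (cobdd c hc) (upper c hc)
  have hG_ge (c : ℝ) (hc : 0 ≤ c) : a + c * m ≤ G c :=
    le_limsup_of_frequently_le (lower c hc).frequently (bdd c hc)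
  have hcont : ContinuousOn G (Set.Ici 0) := by
    refine (LipschitzOnWith.of_le_add_mul m'.toNNReal ?_).continuousOn
    intro c hc d hd
    have hc : 0 ≤ c := hc
    have hd : 0 ≤ d := hd
    rw [Real.coe_toNNReal _ hm'.le, ← limsup_add_const _ _ _ (bdd d hd) (cobdd d hd)]
    refine limsup_le_limsup ?_ (cobdd c hc) ?_
    · filter_upwards [hq] with t ht
      have h1 : (c - d) * q t ≤ |c - d| * q t :=
        mul_le_mul_of_nonneg_right (le_abs_self _) (by linarith)
      have h2 : |c - d| * q t ≤ |c - d| * m' := mul_le_mul_of_nonneg_left ht.2 (abs_nonneg _)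
      rw [Real.dist_eq]
      linarith
    · refine isBoundedUnder_of_eventually_le (a := b + d * m' + m' * dist c d) ?_
      filter_upwards [upper d hd] with t ht
      linarith
  have hc₁ : 0 ≤ (lam - a) / m := div_nonneg (by linarith) hm.le
  have hmem : lam ∈ Set.Icc (G 0) (G ((lam - a) / m)) := by
    refine ⟨by linarith [hG_le 0 le_rfl], ?_⟩
    have := hG_ge _ hc₁
    rw [div_mul_cancel₀ _ hm.ne'] at this
    linarith
  obtain ⟨c, hc, hGc⟩ := intermediate_value_Icc hc₁ (hcont.mono Set.Icc_subset_Ici_self) hmem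
  refine ⟨c, hc.1, ?_, hGc ▸ hG_le c hc.1⟩
  rw [← hGc]
  exact (Monotone.map_limsup_of_continuousAt EReal.coe_strictMono.monotone _
    continuous_coe_real_ereal.continuousAt (bdd c hc.1) (cobdd c hc.1)).symm

theorem intervalIntegrable_comp_mul_log {f : ℝ → ℝ} (hf : Continuous f) (ω : ℝ) {a b : ℝ}
    (ha : 0 < a) (hb : 0 < b) :
    IntervalIntegrable (fun u => f (ω * Real.log u)) MeasureTheory.volume a b := by
  refine ContinuousOn.intervalIntegrable fun u hu => ContinuousAt.continuousWithinAt ?_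
  have hu : 0 < u := (lt_min ha hb).trans_le hu.1
  exact hf.continuousAt.comp (continuousAt_const.mul (Real.continuousAt_log hu.ne'))

theorem hasDerivAt_integral_comp_mul_log {f : ℝ → ℝ} (hf : Continuous f) (ω : ℝ) {t : ℝ}
    (ht : 0 < t) :
    HasDerivAt (fun t => ∫ u in (1 : ℝ)..t, f (ω * Real.log u)) (f (ω * Real.log t)) t :=
  intervalIntegral.integral_hasDerivAt_right
    (intervalIntegrable_comp_mul_log hf ω one_pos ht)
    (hf.measurable.comp
      (Real.measurable_log.const_mul ω)).stronglyMeasurable.stronglyMeasurableAtFilter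
    (hf.continuousAt.comp (continuousAt_const.mul (Real.continuousAt_log ht.ne')))

/-- For a periodic `f`, the time average of `f (ω * log u)` is close to the mean of `f` when `ω` is
large. -/
theorem exists_abs_integral_comp_mul_log_sub_le {f : ℝ → ℝ} {T : ℝ} (hf : Continuous f)
    (hT : 0 < T) (hper : Function.Periodic f T) :
    ∃ C : ℝ, 0 ≤ C ∧ ∀ ω : ℝ, 0 < ω → ∀ t : ℝ, 1 ≤ t →
      |(∫ u in (1 : ℝ)..t, f (ω * Real.log u)) - (∫ x in (0 : ℝ)..T, f x) / T * t|
        ≤ C * (t / ω) + C := by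
  set M := (∫ x in (0 : ℝ)..T, f x) / T with hM
  set H : ℝ → ℝ := fun s => ∫ x in (0 : ℝ)..s, (f x - M) with hH
  have hfM : Continuous fun x => f x - M := by fun_prop
  have hHd (s : ℝ) : HasDerivAt H (f s - M) s :=
    intervalIntegral.integral_hasDerivAt_right (hfM.intervalIntegrable _ _)
      (hfM.stronglyMeasurableAtFilter _ _) hfM.continuousAt
  have hHc : Continuous H := continuous_iff_continuousAt.2 fun s => (hHd s).continuousAt
  have hHper : Function.Periodic H T := by
    intro s
    have h1 : H (s + T) = H s + ∫ x in s..(s + T), (f x - M) :=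
      (intervalIntegral.integral_add_adjacent_intervals (hfM.intervalIntegrable _ _)
        (hfM.intervalIntegrable _ _)).symm
    have h2 : ∫ x in s..(s + T), (f x - M) = 0 := by
      rw [intervalIntegral.integral_sub (hf.intervalIntegrable _ _) (by simp),
        hper.intervalIntegral_add_eq s 0]
      simp only [zero_add, intervalIntegral.integral_const, smul_eq_mul, add_sub_cancel_left]
      rw [hM]
      field_simp
      ring
    rw [h1, h2, add_zero]
  obtain ⟨K, hK⟩ : ∃ K, ∀ s, |H s| ≤ K := by
    obtain ⟨K, hK⟩ := (hHper.compact_of_continuous hT.ne' hHc).isBounded.exists_norm_le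
    exact ⟨K, fun s => hK _ ⟨s, rfl⟩⟩
  have hK0 : 0 ≤ K := (abs_nonneg _).trans (hK 0)
  refine ⟨2 * K + |M|, by positivity, fun ω hω t ht => ?_⟩
  have ht0 : 0 < t := by linarith
  have hpos {x : ℝ} (hx : x ∈ Set.uIcc 1 t) : 0 < x := by
    rw [Set.uIcc_of_le ht] at hx
    linarith [hx.1]
  have hderiv (x : ℝ) (hx : x ∈ Set.uIcc 1 t) :
      HasDerivAt (fun u => u * H (ω * Real.log u) / ω)
        (H (ω * Real.log x) / ω + (f (ω * Real.log x) - M)) x := by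
    have hx0 := (hpos hx).ne'
    have := (((hasDerivAt_id x).mul
      ((hHd _).comp x ((Real.hasDerivAt_log hx0).const_mul ω))).div_const ω)
    refine this.congr_deriv ?_
    simp only [id, Function.comp]
    field_simp
  have i1 := intervalIntegrable_comp_mul_log hHc ω one_pos ht0
  have i2 := intervalIntegrable_comp_mul_log hf ω one_pos ht0
  have key := intervalIntegral.integral_eq_sub_of_hasDerivAt hderiv
    ((i1.div_const ω).add (i2.sub (by simp)))
  rw [intervalIntegral.integral_add (i1.div_const ω) (i2.sub (by simp)),
    intervalIntegral.integral_sub i2 (by simp)] at key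
  simp only [intervalIntegral.integral_const, smul_eq_mul, Real.log_one, mul_zero,
    show H 0 = 0 from intervalIntegral.integral_same, zero_div, sub_zero,
    intervalIntegral.integral_div] at key
  have hIH : |∫ u in (1 : ℝ)..t, H (ω * Real.log u)| ≤ K * t := by
    have := intervalIntegral.norm_integral_le_of_norm_le_const (a := 1) (b := t)
      (f := fun u => H (ω * Real.log u)) (C := K) fun x _ => hK _
    rw [Real.norm_eq_abs, abs_of_nonneg (by linarith : 0 ≤ t - 1)] at this
    nlinarith
  have e : (∫ u in (1 : ℝ)..t, f (ω * Real.log u)) - M * t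
      = t * H (ω * Real.log t) / ω - (∫ u in (1 : ℝ)..t, H (ω * Real.log u)) / ω - M := by
    linarith
  have b1 : |t * H (ω * Real.log t) / ω| ≤ K * (t / ω) := by
    rw [abs_div, abs_mul, abs_of_pos ht0, abs_of_pos hω, mul_comm t, mul_div_assoc]
    exact mul_le_mul_of_nonneg_right (hK _) (by positivity)
  have b2 : |(∫ u in (1 : ℝ)..t, H (ω * Real.log u)) / ω| ≤ K * (t / ω) := by
    rw [abs_div, abs_of_pos hω, ← mul_div_assoc]
    exact div_le_div_of_nonneg_right hIH hω.le
  have htω : 0 ≤ t / ω := by positivity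
  rw [e]
  refine (abs_sub _ _).trans ((add_le_add_left (abs_sub _ _) _).trans ?_)
  nlinarith [mul_nonneg (abs_nonneg M) htω]

/-- Adding a suitable multiple of the average of a slowly oscillating nonnegative function to a
bounded function near `-L` produces the limsup `lam`, while the integral compensates `L * t`. -/
theorem exists_limsup_add_average_eq {f : ℝ → ℝ} {T x₀ L σ lam : ℝ} (hf : Continuous f)
    (hT : 0 < T) (hper : Function.Periodic f T) (hf0 : ∀ x, 0 ≤ f x)
    (hx₀ : x₀ ∈ Set.Icc 0 T) (hfx₀ : 0 < f x₀) (hσ : 0 < σ) (hlam : σ < lam) (hL : 0 < L) :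
    ∃ ω₀ : ℝ, 0 < ω₀ ∧ ∀ ω, ω₀ ≤ ω → ∀ p : ℝ → ℝ, (∀ᶠ t in atTop, |p t + L| ≤ σ) →
      ∃ c : ℝ, 0 ≤ c ∧
        limsup (fun t => ((p t + c * (1 / t * ∫ u in (1 : ℝ)..t, f (ω * Real.log u)) : ℝ) : EReal))
          atTop = (lam : EReal) ∧
        ∀ᶠ t in atTop, L * t ≤ c * ∫ u in (1 : ℝ)..t, f (ω * Real.log u) := by
  obtain ⟨C, hC, hbound⟩ := exists_abs_integral_comp_mul_log_sub_le hf hT hper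
  set M := (∫ x in (0 : ℝ)..T, f x) / T
  have hM : 0 < M := div_pos (intervalIntegral.integral_pos hT hf.continuousOn
    (fun x _ => hf0 x) ⟨x₀, hx₀, hfx₀⟩) hT
  have hden : 0 < 2 * L + lam - σ := by linarith
  set ε := (lam - σ) * M / (2 * L + lam - σ) with hε
  have hε0 : 0 < ε := div_pos (mul_pos (by linarith) hM) hden
  have hεeq : ε * (2 * L + lam - σ) = (lam - σ) * M := div_mul_cancel₀ _ hden.ne'
  have hεM : ε < M := by
    by_contra! h
    nlinarith [mul_le_mul_of_nonneg_right h hden.le]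
  refine ⟨2 * C / ε + 1, by positivity, fun ω hω p hp => ?_⟩
  have hω0 : 0 < ω := lt_of_lt_of_le (by positivity) hω
  have hCω : C / ω ≤ ε / 2 := by
    have : 2 * C / ε ≤ ω := by linarith
    rw [div_le_iff₀ hε0] at this
    rw [div_le_iff₀ hω0]
    linarith
  have hq : ∀ᶠ t in atTop, M - ε ≤ 1 / t * (∫ u in (1 : ℝ)..t, f (ω * Real.log u)) ∧
      1 / t * (∫ u in (1 : ℝ)..t, f (ω * Real.log u)) ≤ M + ε := by
    filter_upwards [eventually_ge_atTop 1, eventually_ge_atTop (2 * C / ε)] with t h1 h2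
    have ht : 0 < t := by linarith
    rw [div_le_iff₀ hε0] at h2
    have h3 := hbound ω hω0 t h1
    have h4 : C * (t / ω) ≤ ε / 2 * t := by
      rw [← mul_div_assoc, mul_div_right_comm]
      exact mul_le_mul_of_nonneg_right hCω ht.le
    have h5 := abs_le.1 (h3.trans (by linarith : _ ≤ ε * t))
    rw [one_div_mul_eq_div, le_div_iff₀ ht, div_le_iff₀ ht]
    constructor <;> nlinarith [h5.1, h5.2]
  obtain ⟨c, hc, hlim, hle⟩ := exists_limsup_add_mul_eq (p := p) (a := -L - σ) (b := -L + σ)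
    (lam := lam) (hp.mono fun t ht => by constructor <;> linarith [(abs_le.1 ht).1, (abs_le.1 ht).2])
    hq (by linarith) (by linarith) (by linarith)
  refine ⟨c, hc, hlim, ?_⟩
  have hcL : L ≤ c * (M - ε) := by
    have h1 : L + lam - σ ≤ c * (M + ε) := by linarith
    have h2 : L * (M + ε) = (L + lam - σ) * (M - ε) := by linarith
    have h3 := mul_le_mul_of_nonneg_right h1 (by linarith : 0 ≤ M - ε)
    refine le_of_mul_le_mul_right ?_ (by linarith : 0 < M + ε)
    linarith
  filter_upwards [hq, eventually_gt_atTop 0] with t h1 ht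
  have h2 := h1.1
  rw [one_div_mul_eq_div, le_div_iff₀ ht] at h2
  nlinarith [mul_le_mul_of_nonneg_left h2 hc, mul_le_mul_of_nonneg_right hcL ht.le]

theorem norm_fin_two (v : Fin 2 → ℝ) : ‖v‖ = max |v 0| |v 1| := by
  refine le_antisymm ((pi_norm_le_iff_of_nonneg (le_max_of_le_left (abs_nonneg _))).2 fun i => ?_)
    (max_le (norm_le_pi_norm v 0) (norm_le_pi_norm v 1))
  fin_cases i
  exacts [le_max_left _ _, le_max_right _ _]

/-- Abel–Liouville: if the integrated trace of a planar linear system is eventually nonnegative,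
then the product of the norms of two independent solutions is bounded away from zero. -/
theorem exists_le_norm_mul_norm {A : ℝ → Matrix (Fin 2) (Fin 2) ℝ} {Y Z : ℝ → Fin 2 → ℝ}
    {τ : ℝ → ℝ} (hY : ∀ t : ℝ, 1 ≤ t → HasDerivAt Y ((A t).mulVec (Y t)) t)
    (hZ : ∀ t : ℝ, 1 ≤ t → HasDerivAt Z ((A t).mulVec (Z t)) t)
    (hτ : ∀ t : ℝ, 1 ≤ t → HasDerivAt τ (A t).trace t) (hτ0 : ∀ᶠ t in atTop, 0 ≤ τ t)
    (hli : LinearIndependent ℝ ![Y 1, Z 1]) :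
    ∃ w : ℝ, 0 < w ∧ ∀ᶠ t in atTop, w ≤ ‖Y t‖ * ‖Z t‖ := by
  set W : ℝ → ℝ := fun t => Y t 0 * Z t 1 - Y t 1 * Z t 0 with hW
  have hW1 : W 1 ≠ 0 := by
    intro h
    have h : Y 1 0 * Z 1 1 - Y 1 1 * Z 1 0 = 0 := h
    rw [LinearIndependent.pair_iff] at hli
    have ha := hli (Z 1 1) (-Y 1 1) (by
      ext i
      fin_cases i
      · simp; linarith
      · simp; ring)
    have hb := hli (Z 1 0) (-Y 1 0) (by
      ext i
      fin_cases i
      · simp; ring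
      · simp; linarith)
    have hc := hli 1 0 (by
      ext i
      fin_cases i
      · simpa using neg_eq_zero.1 hb.2
      · simpa using neg_eq_zero.1 ha.2)
    exact one_ne_zero hc.1
  have hWd (t : ℝ) (ht : 1 ≤ t) :
      HasDerivAt (fun t => W t * Real.exp (-τ t)) 0 t := by
    have y0 := hasDerivAt_pi.1 (hY t ht) 0
    have y1 := hasDerivAt_pi.1 (hY t ht) 1
    have z0 := hasDerivAt_pi.1 (hZ t ht) 0
    have z1 := hasDerivAt_pi.1 (hZ t ht) 1
    have := ((y0.mul z1).sub (y1.mul z0)).mul (hτ t ht).neg.exp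
    refine this.congr_deriv ?_
    simp only [Matrix.mulVec, dotProduct, Fin.sum_univ_two, Matrix.trace_fin_two, Pi.sub_apply,
      Pi.mul_apply]
    ring
  have hconst (t : ℝ) (ht : 1 ≤ t) : W t * Real.exp (-τ t) = W 1 * Real.exp (-τ 1) :=
    constant_of_has_deriv_right_zero (a := 1) (b := t)
      (fun x hx => (hWd x hx.1).continuousAt.continuousWithinAt)
      (fun x hx => (hWd x hx.1).hasDerivWithinAt) t ⟨ht, le_rfl⟩
  refine ⟨|W 1 * Real.exp (-τ 1)| / 2, by positivity, ?_⟩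
  filter_upwards [hτ0, eventually_ge_atTop 1] with t h0 h1
  rw [← hconst t h1, abs_mul, Real.abs_exp]
  have hexp : Real.exp (-τ t) ≤ 1 := Real.exp_le_one_iff.2 (by linarith)
  have hWle : |W t| ≤ 2 * (‖Y t‖ * ‖Z t‖) := by
    have h1 : |Y t 0 * Z t 1| ≤ ‖Y t‖ * ‖Z t‖ := by
      rw [abs_mul]
      exact mul_le_mul (norm_le_pi_norm (Y t) 0) (norm_le_pi_norm (Z t) 1) (abs_nonneg _)
        (norm_nonneg _)
    have h2 : |Y t 1 * Z t 0| ≤ ‖Y t‖ * ‖Z t‖ := by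
      rw [abs_mul]
      exact mul_le_mul (norm_le_pi_norm (Y t) 1) (norm_le_pi_norm (Z t) 0) (abs_nonneg _)
        (norm_nonneg _)
    have := abs_sub (Y t 0 * Z t 1) (Y t 1 * Z t 0)
    linarith
  have := mul_le_mul_of_nonneg_left hexp (abs_nonneg (W t))
  linarith

/-- If `‖Y‖ * ‖Z‖` is bounded away from zero, the Lyapunov exponents of `Y` and `Z` have
nonnegative sum. -/
theorem neg_limsup_log_norm_le {E : Type*} [NormedAddCommGroup E] {Y Z : ℝ → E} {w : ℝ}
    (hw : 0 < w) (h : ∀ᶠ t in atTop, w ≤ ‖Y t‖ * ‖Z t‖) :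
    - limsup (fun t : ℝ => ((1 / t * Real.log ‖Y t‖ : ℝ) : EReal)) atTop ≤
      limsup (fun t : ℝ => ((1 / t * Real.log ‖Z t‖ : ℝ) : EReal)) atTop := by
  refine le_of_forall_lt fun a ha => ?_
  obtain ⟨r, har, hr⟩ := EReal.lt_iff_exists_real_btwn.1 ha
  refine har.trans_le ?_
  have hr' := EReal.lt_neg_comm.1 hr
  obtain ⟨s, hs, hsr⟩ := EReal.lt_iff_exists_real_btwn.1 hr'
  have hsr : s < -r := by exact_mod_cast hsr
  have hlim : Tendsto (fun t : ℝ => 1 / t * Real.log w) atTop (nhds 0) := by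
    simpa using tendsto_inv_atTop_zero.mul_const (Real.log w)
  refine le_limsup_of_frequently_le (Eventually.frequently ?_)
  filter_upwards [h, eventually_lt_of_limsup_lt hs,
    hlim.eventually_const_lt (by linarith : s + r < 0),
    eventually_gt_atTop 0] with t h1 h2 h3 ht
  have h2 : 1 / t * Real.log ‖Y t‖ < s := by exact_mod_cast h2
  have hpos := hw.trans_le h1
  have hY : ‖Y t‖ ≠ 0 := left_ne_zero_of_mul hpos.ne'
  have hZ : ‖Z t‖ ≠ 0 := right_ne_zero_of_mul hpos.ne'
  have h4 := Real.log_le_log hw h1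
  rw [Real.log_mul hY hZ] at h4
  have h5 := mul_le_mul_of_nonneg_left h4 (by positivity : 0 ≤ 1 / t)
  rw [mul_add] at h5
  exact_mod_cast (by linarith : r ≤ 1 / t * Real.log ‖Z t‖)

theorem hasDerivAt_mul_sin_mul_log (ω : ℝ) {t : ℝ} (ht : t ≠ 0) :
    HasDerivAt (fun t => t * Real.sin (ω * Real.log t))
      (Real.sin (ω * Real.log t) + ω * Real.cos (ω * Real.log t)) t := by
  have := (hasDerivAt_id t).mul ((Real.hasDerivAt_log ht).const_mul ω).sin
  refine this.congr_deriv ?_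
  simp only [id]
  field_simp

theorem abs_add_mul_sin_add_mul_le (L ω c g x : ℝ) {σ : ℝ} (hg0 : 0 ≤ g) (hg1 : g ≤ 1) :
    |L + σ * (Real.sin x + ω * Real.cos x) + c * g| ≤ |L| + |σ| * (1 + |ω|) + |c| := by
  refine (abs_add_le _ _).trans (add_le_add ((abs_add_le _ _).trans (add_le_add_right ?_ _)) ?_)
  · rw [abs_mul]
    refine mul_le_mul_of_nonneg_left ((abs_add_le _ _).trans
      (add_le_add (Real.abs_sin_le_one x) ?_)) (abs_nonneg _)
    rw [abs_mul]
    exact mul_le_of_le_one_right (abs_nonneg _) (Real.abs_cos_le_one x)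
  · rw [abs_mul, abs_of_nonneg hg0]
    exact mul_le_of_le_one_right (abs_nonneg _) hg1

theorem smoothTransition_mul_exp_le {σ s t : ℝ} (hσ : 0 ≤ σ) (ht : 0 ≤ t) :
    Real.smoothTransition (s - 1 / 2) * Real.exp (-(2 * σ * (t * s))) ≤ Real.exp (-σ * t) := by
  rcases le_total s (1 / 2) with hs | hs
  · rw [Real.smoothTransition.zero_of_nonpos (by linarith), zero_mul]
    positivity
  · refine (mul_le_of_le_one_left (Real.exp_pos _).le (Real.smoothTransition.le_one _)).trans
      (Real.exp_le_exp.2 ?_)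
    nlinarith [mul_le_mul_of_nonneg_left hs (mul_nonneg hσ ht)]

/-- Deterministic (pathwise) core of Theorem 2.1: there are a bounded smooth planar system
with Lyapunov exponents `λ₂ ≥ λ₁ > 0` and an exponentially decaying smooth perturbation
such that the perturbed system has a solution with negative Lyapunov exponent
`λ₀ ≤ θσ/(θ-1) - ((θ+1)/(θ-1))λ₁ < 0`, and every solution linearly independent of it has
Lyapunov exponent at least `-λ₀ > 0`. -/
theorem stmt12 (lam1 lam2 θ σ : ℝ) (hlam1 : 0 < lam1) (hlam12 : lam1 ≤ lam2) (hθ : 1 < θ)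
    (hσ0 : 0 < σ) (hσ : σ < (θ - 1) * lam1 / θ) :
    ∃ (B Q : ℝ → Matrix (Fin 2) (Fin 2) ℝ) (C : ℝ), 0 < C ∧
      (∀ i j, ContDiffOn ℝ (⊤ : ℕ∞) (fun t => B t i j) (Set.Ici (1:ℝ))) ∧
      (∃ Mb : ℝ, ∀ t : ℝ, 1 ≤ t → ∀ i j, |B t i j| ≤ Mb) ∧
      (∀ i j, ContDiffOn ℝ (⊤ : ℕ∞) (fun t => Q t i j) (Set.Ici (1:ℝ))) ∧
      (∀ t : ℝ, 1 ≤ t → ∀ i j, |Q t i j| ≤ C * Real.exp (-σ * t)) ∧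
      -- (i) the unperturbed equation has Lyapunov exponents λ₁ and λ₂
      (∃ X₁ X₂ : ℝ → Fin 2 → ℝ,
        (∀ t : ℝ, 1 ≤ t → HasDerivAt X₁ ((B t).mulVec (X₁ t)) t) ∧
        (∀ t : ℝ, 1 ≤ t → HasDerivAt X₂ ((B t).mulVec (X₂ t)) t) ∧
        LinearIndependent ℝ ![X₁ 1, X₂ 1] ∧
        Filter.limsup (fun t : ℝ => ((1 / t * Real.log ‖X₁ t‖ : ℝ) : EReal)) Filter.atTop
          = (lam1 : EReal) ∧
        Filter.limsup (fun t : ℝ => ((1 / t * Real.log ‖X₂ t‖ : ℝ) : EReal)) Filter.atTop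
          = (lam2 : EReal)) ∧
      -- (ii) and (iii) for the perturbed equation
      (∃ Y₀ : ℝ → Fin 2 → ℝ, Y₀ 1 ≠ 0 ∧
        (∀ t : ℝ, 1 ≤ t → HasDerivAt Y₀ ((B t + Q t).mulVec (Y₀ t)) t) ∧
        Filter.limsup (fun t : ℝ => ((1 / t * Real.log ‖Y₀ t‖ : ℝ) : EReal)) Filter.atTop
          ≤ ((θ * σ / (θ - 1) - (θ + 1) / (θ - 1) * lam1 : ℝ) : EReal) ∧
        θ * σ / (θ - 1) - (θ + 1) / (θ - 1) * lam1 < 0 ∧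
        (∀ Z : ℝ → Fin 2 → ℝ,
          (∀ t : ℝ, 1 ≤ t → HasDerivAt Z ((B t + Q t).mulVec (Z t)) t) →
          LinearIndependent ℝ ![Y₀ 1, Z 1] →
          Filter.limsup (fun t : ℝ => ((1 / t * Real.log ‖Z t‖ : ℝ) : EReal)) Filter.atTop
            ≥ - Filter.limsup (fun t : ℝ => ((1 / t * Real.log ‖Y₀ t‖ : ℝ) : EReal))
                Filter.atTop)) := by
  have hθ1 : 0 < θ - 1 := by linarith
  have hσθ : σ * θ < (θ - 1) * lam1 := (lt_div_iff₀ (by linarith)).1 hσ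
  have hσlam : σ < lam1 := by nlinarith
  set R := θ * σ / (θ - 1) - (θ + 1) / (θ - 1) * lam1 with hR
  have hR0 : R < 0 := by
    have : R = (θ * σ - (θ + 1) * lam1) / (θ - 1) := by rw [hR]; ring
    rw [this]
    exact div_neg_of_neg_of_pos (by nlinarith) hθ1
  obtain ⟨L, hL⟩ : ∃ L, L = σ - R := ⟨_, rfl⟩
  have hL0 : 0 < L := by linarith
  set f₁ : ℝ → ℝ := fun x => Real.smoothTransition (Real.sin x - 1 / 2) with hf₁
  set f₂ : ℝ → ℝ := fun x => Real.smoothTransition (-Real.sin x - 1 / 2) with hf₂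
  have hf₁d : ContDiff ℝ (⊤ : ℕ∞) f₁ :=
    Real.smoothTransition.contDiff.comp (Real.contDiff_sin.sub contDiff_const)
  have hf₂d : ContDiff ℝ (⊤ : ℕ∞) f₂ :=
    Real.smoothTransition.contDiff.comp (Real.contDiff_sin.neg.sub contDiff_const)
  have hπ := Real.pi_pos
  obtain ⟨ω₁, hω₁, H₁⟩ := exists_limsup_add_average_eq (f := f₁) (T := 2 * Real.pi)
    (x₀ := Real.pi / 2) hf₁d.continuous Real.two_pi_pos (fun x => by simp [hf₁])
    (fun x => Real.smoothTransition.nonneg _) ⟨by linarith, by linarith⟩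
    (Real.smoothTransition.pos_of_pos (by rw [Real.sin_pi_div_two]; norm_num)) hσ0 hσlam hL0
  obtain ⟨ω₂, hω₂, H₂⟩ := exists_limsup_add_average_eq (f := f₂) (T := 2 * Real.pi)
    (x₀ := Real.pi / 2 + Real.pi) hf₂d.continuous Real.two_pi_pos (fun x => by simp [hf₂])
    (fun x => Real.smoothTransition.nonneg _) ⟨by linarith, by linarith⟩
    (Real.smoothTransition.pos_of_pos (by
      rw [Real.sin_add_pi, Real.sin_pi_div_two]; norm_num)) hσ0 (hσlam.trans_le hlam12) hL0
  obtain ⟨ω, hω⟩ : ∃ ω, ω = max ω₁ ω₂ := ⟨_, rfl⟩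
  have hsin (x : ℝ) : |σ * Real.sin x| ≤ σ := by
    rw [abs_mul, abs_of_pos hσ0]
    exact mul_le_of_le_one_right hσ0.le (Real.abs_sin_le_one x)
  obtain ⟨c₁, hc₁, hlim₁, hI₁⟩ := H₁ ω (hω ▸ le_max_left _ _)
    (fun t => -L - σ * Real.sin (ω * Real.log t)) (.of_forall fun t => by
      simpa [abs_neg, sub_eq_add_neg, add_comm] using hsin (ω * Real.log t))
  obtain ⟨c₂, hc₂, hlim₂, hI₂⟩ := H₂ ω (hω ▸ le_max_right _ _)
    (fun t => -L + σ * Real.sin (ω * Real.log t)) (.of_forall fun t => by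
      simpa using hsin (ω * Real.log t))
  set s : ℝ → ℝ := fun t => Real.sin (ω * Real.log t) with hs
  set b : ℝ → ℝ := fun t => Real.sin (ω * Real.log t) + ω * Real.cos (ω * Real.log t) with hb
  set g₁ : ℝ → ℝ := fun t => f₁ (ω * Real.log t) with hg₁
  set g₂ : ℝ → ℝ := fun t => f₂ (ω * Real.log t) with hg₂
  set I₁ : ℝ → ℝ := fun t => ∫ u in (1 : ℝ)..t, f₁ (ω * Real.log u) with hI₁_def
  set I₂ : ℝ → ℝ := fun t => ∫ u in (1 : ℝ)..t, f₂ (ω * Real.log u) with hI₂_def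
  have hsd (t : ℝ) (ht : 1 ≤ t) : HasDerivAt (fun t => t * s t) (b t) t :=
    hasDerivAt_mul_sin_mul_log ω (by linarith)
  have hI₁d (t : ℝ) (ht : 1 ≤ t) : HasDerivAt I₁ (g₁ t) t :=
    hasDerivAt_integral_comp_mul_log hf₁d.continuous ω (by linarith)
  have hI₂d (t : ℝ) (ht : 1 ≤ t) : HasDerivAt I₂ (g₂ t) t :=
    hasDerivAt_integral_comp_mul_log hf₂d.continuous ω (by linarith)
  have hlog : ContDiffOn ℝ (⊤ : ℕ∞) (fun t => ω * Real.log t) (Set.Ici 1) :=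
    contDiffOn_const.mul (contDiffOn_id.log fun t ht => (zero_lt_one.trans_le ht).ne')
  have hsC : ContDiffOn ℝ (⊤ : ℕ∞) s (Set.Ici 1) := Real.contDiff_sin.comp_contDiffOn hlog
  have hbC : ContDiffOn ℝ (⊤ : ℕ∞) b (Set.Ici 1) :=
    hsC.add (contDiffOn_const.mul (Real.contDiff_cos.comp_contDiffOn hlog))
  have hg₁C : ContDiffOn ℝ (⊤ : ℕ∞) g₁ (Set.Ici 1) := hf₁d.comp_contDiffOn hlog
  have hg₂C : ContDiffOn ℝ (⊤ : ℕ∞) g₂ (Set.Ici 1) := hf₂d.comp_contDiffOn hlog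
  have hg₁0 (t : ℝ) : 0 ≤ g₁ t := Real.smoothTransition.nonneg _
  have hg₂0 (t : ℝ) : 0 ≤ g₂ t := Real.smoothTransition.nonneg _
  have hid : ContDiffOn ℝ (⊤ : ℕ∞) (fun t : ℝ => t) (Set.Ici 1) := contDiffOn_id
  refine ⟨fun t => !![-L + -σ * b t + c₁ * g₁ t, 0; 0, -L + σ * b t + c₂ * g₂ t],
    fun t => !![0, -(c₁ * (g₁ t * Real.exp (-(2 * σ * (t * s t)))));
      -(c₂ * (g₂ t * Real.exp (-(2 * σ * (t * -s t))))), 0],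
    c₁ + c₂ + 1, by positivity, ?_, ?_, ?_, ?_, ?_, ?_⟩
  · intro i j
    fin_cases i <;> fin_cases j
    · exact (contDiffOn_const.add (contDiffOn_const.mul hbC)).add (contDiffOn_const.mul hg₁C)
    · exact contDiffOn_const
    · exact contDiffOn_const
    · exact (contDiffOn_const.add (contDiffOn_const.mul hbC)).add (contDiffOn_const.mul hg₂C)
  · refine ⟨|L| + |σ| * (1 + |ω|) + |c₁| + |c₂|, fun t _ i j => ?_⟩
    have e₁ := abs_add_mul_sin_add_mul_le (-L) ω c₁ (g₁ t) (ω * Real.log t) (σ := -σ) (hg₁0 t)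
      (Real.smoothTransition.le_one _)
    have e₂ := abs_add_mul_sin_add_mul_le (-L) ω c₂ (g₂ t) (ω * Real.log t) (σ := σ) (hg₂0 t)
      (Real.smoothTransition.le_one _)
    rw [abs_neg] at e₁ e₂
    rw [abs_neg] at e₁
    have h₁ := abs_nonneg c₁
    have h₂ := abs_nonneg c₂
    fin_cases i <;> fin_cases j
    · exact e₁.trans (by linarith)
    · simp; positivity
    · simp; positivity
    · exact e₂.trans (by linarith)
  · intro i j
    fin_cases i <;> fin_cases j
    · exact contDiffOn_const
    · exact (contDiffOn_const.mul (hg₁C.mul (contDiffOn_const.mul (hid.mul hsC)).neg.exp)).neg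
    · exact (contDiffOn_const.mul (hg₂C.mul (contDiffOn_const.mul (hid.mul hsC.neg)).neg.exp)).neg
    · exact contDiffOn_const
  · intro t ht i j
    have ht0 : 0 ≤ t := by linarith
    have e₁ : g₁ t * Real.exp (-(2 * σ * (t * s t))) ≤ Real.exp (-σ * t) :=
      smoothTransition_mul_exp_le hσ0.le ht0
    have e₂ : g₂ t * Real.exp (-(2 * σ * (t * -s t))) ≤ Real.exp (-σ * t) :=
      smoothTransition_mul_exp_le hσ0.le ht0
    have hE := Real.exp_pos (-σ * t)
    have m₁ := mul_le_mul_of_nonneg_left e₁ hc₁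
    have m₂ := mul_le_mul_of_nonneg_left e₂ hc₂
    have n₁ := mul_nonneg hc₁ hE.le
    have n₂ := mul_nonneg hc₂ hE.le
    have p₁ := mul_nonneg hc₁ (mul_nonneg (hg₁0 t) (Real.exp_pos (-(2 * σ * (t * s t)))).le)
    have p₂ := mul_nonneg hc₂ (mul_nonneg (hg₂0 t) (Real.exp_pos (-(2 * σ * (t * -s t)))).le)
    fin_cases i <;> fin_cases j
    · simp; positivity
    · change |-(c₁ * (g₁ t * Real.exp (-(2 * σ * (t * s t)))))| ≤ _
      rw [abs_neg, abs_of_nonneg p₁]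
      linarith
    · change |-(c₂ * (g₂ t * Real.exp (-(2 * σ * (t * -s t)))))| ≤ _
      rw [abs_neg, abs_of_nonneg p₂]
      linarith
    · simp; positivity
  · refine ⟨fun t => ![Real.exp (-L * t - σ * (t * s t) + c₁ * I₁ t), 0],
      fun t => ![0, Real.exp (-L * t + σ * (t * s t) + c₂ * I₂ t)], ?_, ?_, ?_, ?_, ?_⟩
    · intro t ht
      refine hasDerivAt_pi.2 fun i => ?_
      fin_cases i
      · refine (((((hasDerivAt_id t).const_mul (-L)).sub ((hsd t ht).const_mul σ)).add
          ((hI₁d t ht).const_mul c₁)).exp).congr_deriv ?_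
        simp
        ring
      · simpa using hasDerivAt_const t (0 : ℝ)
    · intro t ht
      refine hasDerivAt_pi.2 fun i => ?_
      fin_cases i
      · simpa using hasDerivAt_const t (0 : ℝ)
      · refine (((((hasDerivAt_id t).const_mul (-L)).add ((hsd t ht).const_mul σ)).add
          ((hI₂d t ht).const_mul c₂)).exp).congr_deriv ?_
        simp
    · rw [LinearIndependent.pair_iff]
      intro x y hxy
      have h0 := congrFun hxy 0
      have h1 := congrFun hxy 1
      simpa [Real.exp_ne_zero] using And.intro h0 h1
    · rw [← hlim₁]
      refine limsup_congr ?_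
      filter_upwards [eventually_gt_atTop 0] with t ht
      rw [norm_fin_two]
      simp only [Matrix.cons_val_zero, Matrix.cons_val_one, abs_zero, Real.abs_exp,
        max_eq_left (Real.exp_pos _).le, Real.log_exp]
      congr 1
      field_simp
      rfl
    · rw [← hlim₂]
      refine limsup_congr ?_
      filter_upwards [eventually_gt_atTop 0] with t ht
      rw [norm_fin_two]
      simp only [Matrix.cons_val_zero, Matrix.cons_val_one, abs_zero, Real.abs_exp,
        max_eq_right (Real.exp_pos _).le, Real.log_exp]
      congr 1
      field_simp
      rfl
  · have hY (t : ℝ) (ht : 1 ≤ t) : HasDerivAt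
        (fun t => ![Real.exp (-L * t - σ * (t * s t)), Real.exp (-L * t + σ * (t * s t))])
        ((!![-L + -σ * b t + c₁ * g₁ t, 0; 0, -L + σ * b t + c₂ * g₂ t] +
          !![0, -(c₁ * (g₁ t * Real.exp (-(2 * σ * (t * s t)))));
            -(c₂ * (g₂ t * Real.exp (-(2 * σ * (t * -s t))))), 0]).mulVec
          ![Real.exp (-L * t - σ * (t * s t)), Real.exp (-L * t + σ * (t * s t))]) t := by
      have hE₁ : Real.exp (-L * t - σ * (t * s t)) =
          Real.exp (-(2 * σ * (t * s t))) * Real.exp (-L * t + σ * (t * s t)) := by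
        rw [← Real.exp_add]; ring_nf
      have hE₂ : Real.exp (-L * t + σ * (t * s t)) =
          Real.exp (-(2 * σ * (t * -s t))) * Real.exp (-L * t - σ * (t * s t)) := by
        rw [← Real.exp_add]; ring_nf
      refine hasDerivAt_pi.2 fun i => ?_
      fin_cases i
      · refine ((((hasDerivAt_id t).const_mul (-L)).sub
          ((hsd t ht).const_mul σ)).exp).congr_deriv ?_
        simp [Matrix.mulVec, dotProduct, Fin.sum_univ_two] at hE₁ ⊢
        linear_combination (c₁ * g₁ t) * (-hE₁)
      · refine ((((hasDerivAt_id t).const_mul (-L)).add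
          ((hsd t ht).const_mul σ)).exp).congr_deriv ?_
        simp [Matrix.mulVec, dotProduct, Fin.sum_univ_two] at hE₂ ⊢
        linear_combination (c₂ * g₂ t) * (-hE₂)
    refine ⟨_, ?_, hY, ?_, hR0, fun Z hZ hli => ?_⟩
    · intro h
      simpa [Real.exp_ne_zero] using congrFun h 0
    · refine limsup_le_of_le (by isBoundedDefault) ?_
      filter_upwards [eventually_gt_atTop 0] with t ht
      have hst := mul_le_mul_of_nonneg_left (abs_le.1 (hsin (ω * Real.log t))).2 ht.le
      have hst' := mul_le_mul_of_nonneg_left (abs_le.1 (hsin (ω * Real.log t))).1 ht.le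
      have hle : ‖![Real.exp (-L * t - σ * (t * s t)), Real.exp (-L * t + σ * (t * s t))]‖
          ≤ Real.exp (t * R) := by
        rw [norm_fin_two]
        simp only [Matrix.cons_val_zero, Matrix.cons_val_one, Real.abs_exp]
        refine max_le (Real.exp_le_exp.2 ?_) (Real.exp_le_exp.2 ?_)
        · rw [hL]; simp only [hs]; linarith
        · rw [hL]; simp only [hs]; linarith
      have hpos : 0 < ‖![Real.exp (-L * t - σ * (t * s t)),
          Real.exp (-L * t + σ * (t * s t))]‖ := by
        rw [norm_fin_two]
        exact lt_max_of_lt_left (abs_pos.2 (Real.exp_ne_zero _))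
      have := Real.log_le_log hpos hle
      rw [Real.log_exp] at this
      rw [EReal.coe_le_coe_iff, one_div_mul_eq_div, div_le_iff₀' ht]
      exact this
    · obtain ⟨w, hw, hwle⟩ := exists_le_norm_mul_norm hY hZ
        (τ := fun t => -L * t + c₁ * I₁ t + (-L * t + c₂ * I₂ t)) (fun t ht => by
          refine ((((hasDerivAt_id t).const_mul (-L)).add ((hI₁d t ht).const_mul c₁)).add
            (((hasDerivAt_id t).const_mul (-L)).add ((hI₂d t ht).const_mul c₂))).congr_deriv ?_
          simp [Matrix.trace_fin_two]
          ring)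
        (by
          filter_upwards [hI₁, hI₂] with t h1 h2
          linarith) hli
      exact neg_limsup_log_norm_le hw hwle
end

section
/- Let n ≥ 3, let λ_n ≥ … ≥ λ₂ ≥ λ₁ > 0, let θ > 1, and let σ satisfy 0 < σ < (θ−1)λ₁/θ. Then there exist a bounded C^∞ matrix function B : [T₁, ∞) → Mat_n(ℝ) and a C^∞ matrix function Q : [T₁, ∞) → Mat_n(ℝ) with ‖Q(t)‖ ≤ C e^{−σt} for all t ≥ T₁ (for some constant C > 0) such that: (i) the equation Y′ = B(t)Y has n linearly independent solutions with Lyapunov exponents λ₁, …, λ_n; (ii) the perturbed equation Y′ = (B(t) + Q(t))Y has exactly n−1 linearly independent solutions Y₁, …, Y_{n−1} with negative Lyapunov exponents Λ₁, …, Λ_{n−1}; and (iii) every solution of the perturbed equation linearly independent of Y₁, …, Y_{n−1} has positive Lyapunov exponent greater than |Λ₁ + … + Λ_{n−1}|. -/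
open Filter
open scoped Topology

/-- The Lyapunov exponent of a size function `N`. -/
noncomputable def lyapunovExp (N : ℝ → ℝ) : EReal :=
  limsup (fun t : ℝ => ((1 / t * Real.log (N t) : ℝ) : EReal)) atTop

theorem tendsto_const_div_add (a l : ℝ) :
    Tendsto (fun t : ℝ => ((1 / t * (a + l * t) : ℝ) : EReal)) atTop (𝓝 (l : EReal)) := by
  refine (continuous_coe_real_ereal.tendsto l).comp ?_
  have h : Tendsto (fun t : ℝ => a * t⁻¹ + l) atTop (𝓝 (a * 0 + l)) :=
    (tendsto_inv_atTop_zero.const_mul a).add_const l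
  rw [mul_zero, zero_add] at h
  refine h.congr' ?_
  filter_upwards [eventually_gt_atTop 0] with t ht
  field_simp

theorem lyapunovExp_le {N : ℝ → ℝ} {K l : ℝ} (hK : 0 < K)
    (h : ∀ᶠ t in atTop, 0 < N t ∧ N t ≤ K * Real.exp (l * t)) : lyapunovExp N ≤ l := by
  rw [← (tendsto_const_div_add (Real.log K) l).limsup_eq]
  refine limsup_le_limsup ?_
  filter_upwards [h, eventually_gt_atTop 0] with t ⟨h0, h1⟩ ht
  have : Real.log (N t) ≤ Real.log K + l * t := by
    rw [← Real.log_exp (l * t), ← Real.log_mul hK.ne' (Real.exp_pos _).ne']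
    exact Real.log_le_log h0 h1
  exact EReal.coe_le_coe_iff.2 (mul_le_mul_of_nonneg_left this (by positivity))

theorem le_lyapunovExp {N : ℝ → ℝ} {K l : ℝ} (hK : 0 < K)
    (h : ∃ᶠ t in atTop, K * Real.exp (l * t) ≤ N t) : (l : EReal) ≤ lyapunovExp N := by
  refine le_of_forall_lt fun b hb => ?_
  obtain ⟨b', hbb', hb'⟩ := exists_between hb
  have hlim := (tendsto_const_div_add (Real.log K) l).eventually (lt_mem_nhds hb')
  refine hbb'.trans_le (le_limsup_of_frequently_le' ?_)
  refine (h.and_eventually (hlim.and (eventually_gt_atTop 0))).mono ?_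
  rintro t ⟨h1, h2, ht⟩
  have : Real.log K + l * t ≤ Real.log (N t) := by
    rw [← Real.log_exp (l * t), ← Real.log_mul hK.ne' (Real.exp_pos _).ne']
    exact Real.log_le_log (by positivity) h1
  exact h2.le.trans
    (EReal.coe_le_coe_iff.2 (mul_le_mul_of_nonneg_left this (by positivity)))

theorem lyapunovExp_le_add {N M : ℝ → ℝ} {δ : ℝ} (hN : ∀ t, 0 < N t) (hM : ∀ t, 0 < M t)
    (h : ∀ᶠ t in atTop, N t ≤ Real.exp (δ * t) * M t) :
    lyapunovExp N ≤ lyapunovExp M + (δ : EReal) := by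
  have h1 : lyapunovExp N ≤ limsup ((fun t : ℝ => ((1 / t * Real.log (M t) : ℝ) : EReal)) +
      fun _ => (δ : EReal)) atTop := by
    refine limsup_le_limsup ?_
    filter_upwards [h, eventually_gt_atTop 0] with t h1 ht
    have h2 : Real.log (N t) ≤ δ * t + Real.log (M t) := by
      rw [← Real.log_exp (δ * t), ← Real.log_mul (Real.exp_pos _).ne' (hM t).ne']
      exact Real.log_le_log (hN t) h1
    rw [Pi.add_apply, ← EReal.coe_add, EReal.coe_le_coe_iff]
    calc 1 / t * Real.log (N t) ≤ 1 / t * (δ * t + Real.log (M t)) :=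
          mul_le_mul_of_nonneg_left h2 (by positivity)
      _ = 1 / t * Real.log (M t) + δ := by field_simp; ring
  refine h1.trans ((EReal.limsup_add_le ?_ ?_).trans ?_)
  · right; rw [limsup_const]; exact EReal.coe_ne_top _
  · right; rw [limsup_const]; exact EReal.coe_ne_bot _
  · rw [limsup_const]; exact le_rfl

/-- A smooth nonnegative function oscillating between `0` and `2 R t` on a logarithmic scale. -/
noncomputable def logOscillation (R t : ℝ) : ℝ := R * t * (1 - Real.sin (Real.log (1 + t ^ 2)))

theorem contDiff_logOscillation (R : ℝ) : ContDiff ℝ (⊤ : ℕ∞) (logOscillation R) := by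
  unfold logOscillation
  refine (contDiff_const.mul contDiff_id).mul (contDiff_const.sub (Real.contDiff_sin.comp ?_))
  exact (contDiff_const.add (contDiff_id.pow 2)).log fun t => by positivity

theorem continuous_logOscillation (R : ℝ) : Continuous (logOscillation R) :=
  (contDiff_logOscillation R).continuous

theorem abs_deriv_logOscillation_le {R : ℝ} (hR : 0 ≤ R) (t : ℝ) :
    |deriv (logOscillation R) t| ≤ 4 * R := by
  have h1 : HasDerivAt (fun t : ℝ => 1 + t ^ 2) (2 * t) t := by
    simpa using (hasDerivAt_pow 2 t).const_add 1
  have h2 := ((h1.log (by positivity)).sin.const_sub 1)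
  have h3 := ((hasDerivAt_id t).const_mul R).mul h2
  have h4 : deriv (logOscillation R) t = R * (1 - Real.sin (Real.log (1 + t ^ 2))) -
      R * (Real.cos (Real.log (1 + t ^ 2)) * (2 * t ^ 2 / (1 + t ^ 2))) := by
    refine Eq.trans (h3.deriv) ?_
    simp only [id]
    ring
  have h5 : |2 * t ^ 2 / (1 + t ^ 2)| ≤ 2 := by
    rw [abs_of_nonneg (by positivity), div_le_iff₀ (by positivity)]
    linarith
  have h6 : |Real.cos (Real.log (1 + t ^ 2)) * (2 * t ^ 2 / (1 + t ^ 2))| ≤ 2 := by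
    rw [abs_mul]
    nlinarith [Real.abs_cos_le_one (Real.log (1 + t ^ 2)), abs_nonneg (2 * t ^ 2 / (1 + t ^ 2))]
  have h7 : |1 - Real.sin (Real.log (1 + t ^ 2)) -
      Real.cos (Real.log (1 + t ^ 2)) * (2 * t ^ 2 / (1 + t ^ 2))| ≤ 4 := by
    have ha := Real.neg_one_le_sin (Real.log (1 + t ^ 2))
    have hb := Real.sin_le_one (Real.log (1 + t ^ 2))
    rw [abs_le] at h6 ⊢
    constructor <;> linarith [h6.1, h6.2]
  rw [h4, ← mul_sub, abs_mul, abs_of_nonneg hR]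
  nlinarith

theorem logOscillation_nonneg {R t : ℝ} (hR : 0 ≤ R) (ht : 0 ≤ t) : 0 ≤ logOscillation R t :=
  mul_nonneg (mul_nonneg hR ht) (by linarith [Real.sin_le_one (Real.log (1 + t ^ 2))])

theorem logOscillation_le {R t : ℝ} (hR : 0 ≤ R) (ht : 0 ≤ t) : logOscillation R t ≤ 2 * R * t := by
  have := mul_le_mul_of_nonneg_left
    (by linarith [Real.neg_one_le_sin (Real.log (1 + t ^ 2))] :
      1 - Real.sin (Real.log (1 + t ^ 2)) ≤ 2) (mul_nonneg hR ht)
  unfold logOscillation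
  linarith

/-- Arbitrarily late zeros of the oscillation, each preceded within a fixed ratio by a unit
interval on which the oscillation is large. -/
theorem frequently_logOscillation_eq_zero (R : ℝ) (hR : 0 ≤ R) :
    ∃ᶠ t in atTop, logOscillation R t = 0 ∧ ∃ s, 0 ≤ s ∧ s + 1 ≤ t ∧ t ≤ Real.exp Real.pi * s ∧
      ∀ r ∈ Set.Icc s (s + 1), R * r ≤ logOscillation R r := by
  have hπ := Real.pi_gt_three
  let u : ℕ → ℝ := fun k => √(Real.exp (Real.pi / 2 + k * (2 * Real.pi)) - 1)
  have hu : Tendsto u atTop atTop := by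
    refine Real.tendsto_sqrt_atTop.comp (tendsto_atTop_add_const_right _ _ ?_)
    refine Real.tendsto_exp_atTop.comp (tendsto_atTop_add_const_left _ _ ?_)
    exact tendsto_natCast_atTop_atTop.atTop_mul_const (by positivity)
  refine hu.frequently (Eventually.frequently ?_)
  filter_upwards [eventually_ge_atTop 1] with k hk
  have hk' : (1 : ℝ) ≤ k := by exact_mod_cast hk
  have hkπ : 2 * Real.pi ≤ k * (2 * Real.pi) := by nlinarith
  have hE : 1 + Real.pi ≤ Real.exp (-Real.pi + k * (2 * Real.pi)) := by
    have := Real.add_one_le_exp (-Real.pi + k * (2 * Real.pi))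
    linarith
  set E := Real.exp (-Real.pi + k * (2 * Real.pi)) with hEdef
  have hE1 : Real.exp (Real.pi / 2 + k * (2 * Real.pi)) =
      Real.exp Real.pi * Real.exp (Real.pi / 2) * E := by
    rw [hEdef, ← Real.exp_add, ← Real.exp_add]; congr 1; ring
  have hE2 : Real.exp (k * (2 * Real.pi)) = Real.exp Real.pi * E := by
    rw [hEdef, ← Real.exp_add]; congr 1; ring
  have hp1 : 4 ≤ Real.exp Real.pi := by linarith [Real.add_one_le_exp Real.pi]
  have hp2 : 2 ≤ Real.exp (Real.pi / 2) := by linarith [Real.add_one_le_exp (Real.pi / 2)]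
  have hpp : Real.exp Real.pi = Real.exp (Real.pi / 2) * Real.exp (Real.pi / 2) := by
    rw [← Real.exp_add]; congr 1; ring
  have hut : u k ^ 2 = Real.exp Real.pi * Real.exp (Real.pi / 2) * E - 1 := by
    rw [← hE1]
    refine Real.sq_sqrt ?_
    rw [hE1]
    nlinarith [mul_le_mul hp1 hp2 (by norm_num) (by positivity)]
  have hu0 : 0 ≤ u k := Real.sqrt_nonneg _
  have hs2 : √(E - 1) ^ 2 = E - 1 := Real.sq_sqrt (by linarith)
  have hs0 : 0 ≤ √(E - 1) := Real.sqrt_nonneg _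
  set s := √(E - 1)
  refine ⟨?_, s, hs0, ?_, ?_, ?_⟩
  · have : 1 + u k ^ 2 = Real.exp (Real.pi / 2 + k * (2 * Real.pi)) := by rw [hut, hE1]; ring
    rw [logOscillation, this, Real.log_exp, Real.sin_add_nat_mul_two_pi, Real.sin_pi_div_two]
    ring
  · refine abs_le_of_sq_le_sq' ?_ hu0 |>.2
    have : 8 * E ≤ Real.exp Real.pi * Real.exp (Real.pi / 2) * E := by
      have := mul_le_mul hp1 hp2 (by norm_num) (by positivity)
      nlinarith
    nlinarith [sq_nonneg (s - 1)]
  · refine abs_le_of_sq_le_sq' ?_ (by positivity) |>.2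
    rw [hut, mul_pow, hs2]
    have h1 : Real.exp Real.pi * Real.exp (Real.pi / 2) * E ≤
        Real.exp Real.pi ^ 2 * (E / 2) := by
      have : Real.exp (Real.pi / 2) * 2 ≤ Real.exp Real.pi := by rw [hpp]; gcongr
      have := mul_le_mul_of_nonneg_left this (by positivity : 0 ≤ Real.exp Real.pi * (E / 2))
      linarith
    have h2 : Real.exp Real.pi ^ 2 * (E / 2) ≤ Real.exp Real.pi ^ 2 * (E - 1) := by
      gcongr; linarith
    linarith
  · rintro r ⟨hr1, hr2⟩
    have hlow : -Real.pi + k * (2 * Real.pi) ≤ Real.log (1 + r ^ 2) := by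
      rw [Real.le_log_iff_exp_le (by positivity)]
      nlinarith
    have hup : Real.log (1 + r ^ 2) ≤ k * (2 * Real.pi) := by
      rw [Real.log_le_iff_le_exp (by positivity), hE2]
      nlinarith [sq_nonneg (s - 1), mul_le_mul_of_nonneg_right hp1 (by linarith : 0 ≤ E)]
    have hsin : Real.sin (Real.log (1 + r ^ 2)) ≤ 0 := by
      rw [← Real.sin_sub_nat_mul_two_pi _ k]
      exact Real.sin_nonpos_of_nonpos_of_neg_pi_le (by linarith) (by linarith)
    have := mul_nonneg hR (hs0.trans hr1)
    unfold logOscillation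
    nlinarith

/-- The integrating factor picked up by a forcing term of relative decay rate `c`. -/
noncomputable def forcing (R c t : ℝ) : ℝ :=
  1 + ∫ r in (0 : ℝ)..t, Real.exp (logOscillation R r - c * r)

theorem continuous_forcing_integrand (R c : ℝ) :
    Continuous fun r => Real.exp (logOscillation R r - c * r) := by
  have := continuous_logOscillation R
  fun_prop

theorem hasDerivAt_forcing (R c t : ℝ) :
    HasDerivAt (forcing R c) (Real.exp (logOscillation R t - c * t)) t :=
  (((continuous_forcing_integrand R c).integral_hasStrictDerivAt 0 t).hasDerivAt).const_add 1

theorem one_le_forcing {R c t : ℝ} (ht : 0 ≤ t) : 1 ≤ forcing R c t := by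
  have := intervalIntegral.integral_nonneg (μ := MeasureTheory.volume)
    (f := fun r => Real.exp (logOscillation R r - c * r)) ht fun _ _ => (Real.exp_pos _).le
  unfold forcing
  linarith

theorem forcing_anti {R c d t : ℝ} (hcd : c ≤ d) (ht : 0 ≤ t) :
    forcing R d t ≤ forcing R c t := by
  unfold forcing
  gcongr
  refine intervalIntegral.integral_mono_on ht
    ((continuous_forcing_integrand R d).intervalIntegrable _ _)
    ((continuous_forcing_integrand R c).intervalIntegrable _ _) fun r hr => ?_
  gcongr
  exact hr.1

theorem forcing_le_exp_mul {R c d t : ℝ} (hcd : c ≤ d) (ht : 0 ≤ t) :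
    forcing R c t ≤ Real.exp ((d - c) * t) * forcing R d t := by
  unfold forcing
  rw [mul_add, ← intervalIntegral.integral_const_mul]
  have h1 : 0 ≤ (d - c) * t := mul_nonneg (by linarith) ht
  have := Real.one_le_exp h1
  rw [mul_one]
  gcongr
  refine intervalIntegral.integral_mono_on ht
    ((continuous_forcing_integrand R c).intervalIntegrable _ _)
    (((continuous_forcing_integrand R d).const_mul _).intervalIntegrable _ _) fun r hr => ?_
  rw [← Real.exp_add]
  gcongr
  nlinarith [hr.2, mul_le_mul_of_nonneg_left hr.2 (by linarith : 0 ≤ d - c)]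

theorem forcing_le_exp {R c t : ℝ} (hR : 0 ≤ R) (hc : 0 ≤ c) (ht : 0 ≤ t) :
    forcing R c t ≤ Real.exp ((2 * R + 1) * t) := by
  have h1 : (∫ r in (0 : ℝ)..t, Real.exp (logOscillation R r - c * r)) ≤
      ∫ _ in (0 : ℝ)..t, Real.exp (2 * R * t) := by
    refine intervalIntegral.integral_mono_on ht
      ((continuous_forcing_integrand R c).intervalIntegrable _ _)
      (continuous_const.intervalIntegrable _ _) fun r hr => ?_
    gcongr
    have := logOscillation_le hR hr.1
    nlinarith [hr.1, hr.2, mul_nonneg hc hr.1, mul_le_mul_of_nonneg_left hr.2 hR]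
  rw [intervalIntegral.integral_const, sub_zero, smul_eq_mul] at h1
  have h2 : 1 ≤ Real.exp (2 * R * t) := Real.one_le_exp (by positivity)
  have h3 : (t + 1) * Real.exp (2 * R * t) ≤ Real.exp t * Real.exp (2 * R * t) := by
    gcongr; exact Real.add_one_le_exp t
  rw [← Real.exp_add] at h3
  rw [show (2 * R + 1) * t = t + 2 * R * t by ring]
  unfold forcing
  linarith

theorem forcing_le_two {R t : ℝ} (hR : 0 ≤ R) (ht : 0 ≤ t) : forcing R (2 * R + 1) t ≤ 2 := by
  have h1 : (∫ r in (0 : ℝ)..t, Real.exp (logOscillation R r - (2 * R + 1) * r)) ≤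
      ∫ r in (0 : ℝ)..t, Real.exp (-r) := by
    refine intervalIntegral.integral_mono_on ht
      ((continuous_forcing_integrand R _).intervalIntegrable _ _)
      (Real.continuous_exp.comp continuous_neg |>.intervalIntegrable _ _) fun r hr => ?_
    gcongr
    linarith [logOscillation_le hR hr.1]
  have h2 : (∫ r in (0 : ℝ)..t, Real.exp (-r)) = 1 - Real.exp (-t) := by
    rw [intervalIntegral.integral_comp_neg (fun r => Real.exp r), integral_exp]; simp
  have := Real.exp_pos (-t)
  unfold forcing
  linarith

theorem exp_le_forcing {R c s t : ℝ} (hc : c ≤ R) (hs : 0 ≤ s) (hst : s + 1 ≤ t)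
    (h : ∀ r ∈ Set.Icc s (s + 1), R * r ≤ logOscillation R r) :
    Real.exp ((R - c) * s) ≤ forcing R c t := by
  have h1 : (∫ _ in s..(s + 1), Real.exp ((R - c) * s)) ≤
      ∫ r in s..(s + 1), Real.exp (logOscillation R r - c * r) := by
    refine intervalIntegral.integral_mono_on (by linarith)
      (continuous_const.intervalIntegrable _ _)
      ((continuous_forcing_integrand R c).intervalIntegrable _ _) fun r hr => ?_
    gcongr
    nlinarith [h r hr, hr.1]
  have h2 := intervalIntegral.integral_mono_interval (μ := MeasureTheory.volume)
    (f := fun r => Real.exp (logOscillation R r - c * r)) (c := 0) (d := t) hs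
    (by linarith : s ≤ s + 1) hst (MeasureTheory.ae_of_all _ fun _ => (Real.exp_pos _).le)
    ((continuous_forcing_integrand R c).intervalIntegrable _ _)
  simp only [intervalIntegral.integral_const, add_sub_cancel_left, one_smul] at h1
  unfold forcing
  linarith

/-- The growth of a solution of the unperturbed system with forcing rate `c`. -/
noncomputable def solutionSize (l ε R c t : ℝ) : ℝ :=
  max (Real.exp (-ε * t)) (Real.exp (l * t - logOscillation R t) * forcing R c |t|)

theorem solutionSize_pos (l ε R c t : ℝ) : 0 < solutionSize l ε R c t :=
  (Real.exp_pos _).trans_le (le_max_left _ _)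

theorem solutionSize_anti {l ε R c d : ℝ} (hcd : c ≤ d) (t : ℝ) :
    solutionSize l ε R d t ≤ solutionSize l ε R c t := by
  unfold solutionSize
  gcongr
  exact forcing_anti hcd (abs_nonneg t)

theorem le_lyapunovExp_solutionSize {l ε R c : ℝ} (hR : 0 ≤ R) :
    (l : EReal) ≤ lyapunovExp (solutionSize l ε R c) := by
  refine le_lyapunovExp one_pos ((frequently_logOscillation_eq_zero R hR).mono ?_)
  rintro t ⟨h0, -⟩
  refine le_trans ?_ (le_max_right _ _)
  rw [h0, sub_zero, one_mul]
  exact le_mul_of_one_le_right (Real.exp_pos _).le (one_le_forcing (abs_nonneg t))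

theorem solutionSize_le {l ε R c K m t : ℝ} (hl : 0 < l) (hε : 0 < ε) (hR : 0 ≤ R) (ht : 0 ≤ t)
    (hK : 1 ≤ K) (hm : 0 ≤ m) (h : forcing R c t ≤ K * Real.exp (m * t)) :
    solutionSize l ε R c t ≤ K * Real.exp ((l + m) * t) := by
  unfold solutionSize
  rw [abs_of_nonneg ht]
  refine max_le ?_ ?_
  · have h1 : Real.exp (-ε * t) ≤ Real.exp ((l + m) * t) := by gcongr; linarith
    exact h1.trans (le_mul_of_one_le_left (Real.exp_pos _).le hK)
  · have h1 : Real.exp (l * t - logOscillation R t) ≤ Real.exp (l * t) := by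
      gcongr; linarith [logOscillation_nonneg hR ht]
    have h2 : 0 ≤ forcing R c t := zero_le_one.trans (one_le_forcing ht)
    calc _ ≤ Real.exp (l * t) * (K * Real.exp (m * t)) := by gcongr
      _ = _ := by rw [add_mul, Real.exp_add]; ring

theorem lyapunovExp_solutionSize_le {l ε R c : ℝ} (hl : 0 < l) (hε : 0 < ε) (hR : 0 ≤ R)
    (hc : 0 ≤ c) : lyapunovExp (solutionSize l ε R c) ≤ (l + (2 * R + 1) : ℝ) := by
  refine lyapunovExp_le one_pos ?_
  filter_upwards [eventually_ge_atTop 0] with t ht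
  refine ⟨solutionSize_pos _ _ _ _ _, solutionSize_le hl hε hR ht le_rfl (by positivity) ?_⟩
  rw [one_mul]
  exact forcing_le_exp hR hc ht

theorem exists_lyapunovExp_solutionSize_eq {l ε R c₀ M : ℝ} (hl : 0 < l) (hε : 0 < ε)
    (hc₀ : 0 ≤ c₀) (hR : R = c₀ + Real.exp Real.pi * (M - l)) {x : ℝ}
    (hx : l ≤ x) (hxM : x ≤ M) :
    ∃ c, c₀ ≤ c ∧ lyapunovExp (solutionSize l ε R c) = x := by
  have hM : 0 ≤ Real.exp Real.pi * (M - l) := mul_nonneg (Real.exp_pos _).le (by linarith)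
  have hR0 : 0 ≤ R := by linarith
  set E : ℝ → EReal := fun c => lyapunovExp (solutionSize l ε R c)
  have hbot : ∀ c, E c ≠ ⊥ := fun c =>
    ((EReal.bot_lt_coe l).trans_le (le_lyapunovExp_solutionSize hR0)).ne'
  have htop : ∀ c, 0 ≤ c → E c ≠ ⊤ := fun c hc =>
    ((lyapunovExp_solutionSize_le hl hε hR0 hc).trans_lt (EReal.coe_lt_top _)).ne
  have hcoe : ∀ c, 0 ≤ c → ((E c).toReal : EReal) = E c := fun c hc =>
    EReal.coe_toReal (htop c hc) (hbot c)
  have hanti : ∀ c d, c ≤ d → E d ≤ E c := fun c d hcd => by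
    have := lyapunovExp_le_add (solutionSize_pos l ε R d) (solutionSize_pos l ε R c) (δ := 0)
      (Eventually.of_forall fun t => by simpa using solutionSize_anti hcd t)
    simpa using this
  have hlip : ∀ c d, c ≤ d → E c ≤ E d + ((d - c : ℝ) : EReal) := fun c d hcd => by
    refine lyapunovExp_le_add (solutionSize_pos l ε R c) (solutionSize_pos l ε R d) ?_
    filter_upwards [eventually_ge_atTop 0] with t ht
    unfold solutionSize
    rw [abs_of_nonneg ht, mul_max_of_nonneg _ _ (Real.exp_pos _).le]
    have h1 : 0 ≤ (d - c) * t := mul_nonneg (by linarith) ht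
    refine max_le_max (le_mul_of_one_le_left (Real.exp_pos _).le (Real.one_le_exp h1)) ?_
    rw [mul_left_comm]
    gcongr
    exact forcing_le_exp_mul hcd ht
  have hcont : ContinuousOn (fun c => (E c).toReal) (Set.Icc c₀ (c₀ + (2 * R + 1))) := by
    refine (LipschitzOnWith.of_le_add fun c hc d hd => ?_).continuousOn
    have hc' : 0 ≤ c := hc₀.trans hc.1
    have hd' : 0 ≤ d := hc₀.trans hd.1
    rw [← EReal.coe_le_coe_iff, EReal.coe_add, hcoe c hc', hcoe d hd']
    rcases le_total c d with h | h
    · rw [Real.dist_eq, abs_sub_comm, abs_of_nonneg (sub_nonneg.2 h)]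
      exact hlip c d h
    · refine (hanti d c h).trans ?_
      rw [← hcoe d hd', ← EReal.coe_add, EReal.coe_le_coe_iff]
      linarith [dist_nonneg (x := c) (y := d)]
  have hlow : (E (c₀ + (2 * R + 1))).toReal ≤ x := by
    have h1 : E (2 * R + 1) ≤ l := by
      refine lyapunovExp_le two_pos ?_
      filter_upwards [eventually_ge_atTop 0] with t ht
      refine ⟨solutionSize_pos _ _ _ _ _, ?_⟩
      have := solutionSize_le (c := 2 * R + 1) (K := 2) (m := 0) hl hε hR0 ht (by norm_num) le_rfl
        (by simpa using forcing_le_two hR0 ht)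
      simpa using this
    rw [← EReal.coe_le_coe_iff, hcoe _ (by positivity)]
    exact ((hanti _ _ (by linarith)).trans h1).trans (EReal.coe_le_coe_iff.2 hx)
  have hhigh : x ≤ (E c₀).toReal := by
    rw [← EReal.coe_le_coe_iff, hcoe _ hc₀]
    refine (EReal.coe_le_coe_iff.2 hxM).trans
      (le_lyapunovExp one_pos ((frequently_logOscillation_eq_zero R hR0).mono ?_))
    rintro t ⟨h0, s, hs0, hst, hts, h⟩
    have ht : 0 ≤ t := by linarith
    refine le_trans ?_ (le_max_right _ _)
    rw [h0, sub_zero, one_mul, abs_of_nonneg ht]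
    have h1 : Real.exp ((M - l) * t) ≤ forcing R c₀ t := by
      refine le_trans ?_ (exp_le_forcing (by linarith) hs0 hst h)
      rw [Real.exp_le_exp, hR]
      nlinarith [mul_le_mul_of_nonneg_left hts (by linarith : 0 ≤ M - l)]
    calc Real.exp (M * t) = Real.exp (l * t) * Real.exp ((M - l) * t) := by
          rw [← Real.exp_add]; congr 1; ring
      _ ≤ _ := by gcongr
  obtain ⟨c, hc, hcx⟩ := intermediate_value_Icc' (by linarith) hcont ⟨hlow, hhigh⟩
  refine ⟨c, hc.1, ?_⟩
  change E c = x
  rw [← hcoe c (hc₀.trans hc.1)]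
  exact congrArg _ hcx

theorem norm_cons_single {m : ℕ} (k : Fin m) (x e : ℝ) :
    ‖(Fin.cons x (Pi.single k e) : Fin (m + 1) → ℝ)‖ = max |e| |x| := by
  refine le_antisymm ?_ (max_le ?_ ?_)
  · refine (pi_norm_le_iff_of_nonneg (le_max_of_le_left (abs_nonneg e))).2 fun i => ?_
    refine Fin.cases (le_max_right _ _) (fun j => ?_) i
    rw [Fin.cons_succ, Pi.single_apply]
    split_ifs
    · exact le_max_left _ _
    · rw [norm_zero]; positivity
  · simpa using norm_le_pi_norm (Fin.cons x (Pi.single k e) : Fin (m + 1) → ℝ) k.succ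
  · simpa using norm_le_pi_norm (Fin.cons x (Pi.single k e) : Fin (m + 1) → ℝ) 0

/-- An arrow-shaped matrix: first row `(a, q)` and `-ε` on the rest of the diagonal. -/
def arrowMatrix {m : ℕ} (a ε : ℝ) (q : Fin m → ℝ) : Matrix (Fin (m + 1)) (Fin (m + 1)) ℝ :=
  Matrix.of (Fin.cons (Fin.cons a q) fun k => Fin.cons 0 (Pi.single k (-ε)))

theorem arrowMatrix_mulVec {m : ℕ} (a ε : ℝ) (q : Fin m → ℝ) (x : ℝ) (v : Fin m → ℝ) :
    (arrowMatrix a ε q).mulVec (Fin.cons x v) =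
      Fin.cons (a * x + ∑ k, q k * v k) fun k => -ε * v k := by
  ext i
  refine Fin.cases ?_ (fun j => ?_) i
  · simp [arrowMatrix, Matrix.mulVec, dotProduct, Fin.sum_univ_succ]
  · simp [arrowMatrix, Matrix.mulVec, dotProduct, Fin.sum_univ_succ, Pi.single_apply]

theorem hasDerivAt_cons {m : ℕ} {x : ℝ → ℝ} {v : ℝ → Fin m → ℝ} {x' : ℝ} {v' : Fin m → ℝ} {t : ℝ}
    (hx : HasDerivAt x x' t) (hv : ∀ k, HasDerivAt (fun t => v t k) (v' k) t) :
    HasDerivAt (fun t => (Fin.cons (x t) (v t) : Fin (m + 1) → ℝ)) (Fin.cons x' v') t := by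
  refine hasDerivAt_pi.2 fun i => ?_
  refine Fin.cases ?_ (fun j => ?_) i
  · simpa using hx
  · simpa using hv j

theorem hasDerivAt_single_exp {m : ℕ} (k j : Fin m) (ε t : ℝ) :
    HasDerivAt (fun t => (Pi.single k (Real.exp (-ε * t)) : Fin m → ℝ) j)
      (-ε * (Pi.single k (Real.exp (-ε * t)) : Fin m → ℝ) j) t := by
  rcases eq_or_ne j k with rfl | h
  · simpa [mul_comm] using ((hasDerivAt_id t).const_mul (-ε)).exp
  · simpa [h] using hasDerivAt_const t (0 : ℝ)

theorem hasDerivAt_exp_sub_logOscillation (l R t : ℝ) :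
    HasDerivAt (fun t => Real.exp (l * t - logOscillation R t))
      ((l - deriv (logOscillation R) t) * Real.exp (l * t - logOscillation R t)) t := by
  have h := ((contDiff_logOscillation R).differentiable (by simp) t).hasDerivAt
  simpa [mul_comm] using (((hasDerivAt_id t).const_mul l).sub h).exp

theorem eq_mul_exp_of_hasDerivAt {l R : ℝ} {z : ℝ → ℝ}
    (hz : ∀ t, 0 ≤ t → HasDerivAt z ((l - deriv (logOscillation R) t) * z t) t) {t : ℝ}
    (ht : 0 ≤ t) : z t = z 0 * Real.exp (l * t - logOscillation R t) := by
  have hneg : ∀ t, HasDerivAt (fun t => Real.exp (-(l * t - logOscillation R t)))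
      (-(l - deriv (logOscillation R) t) * Real.exp (-(l * t - logOscillation R t))) t := by
    intro t
    have h := ((contDiff_logOscillation R).differentiable (by simp) t).hasDerivAt
    simpa [mul_comm] using (((hasDerivAt_id t).const_mul l).sub h).neg.exp
  have hconst : ∀ s, 0 ≤ s →
      HasDerivAt (fun t => z t * Real.exp (-(l * t - logOscillation R t))) 0 s := fun s hs =>
    ((hz s hs).mul (hneg s)).congr_deriv (by ring)
  have h := constant_of_has_deriv_right_zero
    (fun s hs => (hconst s hs.1).continuousAt.continuousWithinAt)
    (fun s hs => (hconst s hs.1).hasDerivWithinAt) t (Set.right_mem_Icc.2 ht)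
  have h0 : logOscillation R 0 = 0 := by simp [logOscillation]
  rw [h0, mul_zero, sub_zero, neg_zero, Real.exp_zero, mul_one, Real.exp_neg] at h
  rw [← h]
  field_simp

theorem lyapunovExp_exp (l : ℝ) : lyapunovExp (fun t => Real.exp (l * t)) = l :=
  le_antisymm
    (lyapunovExp_le one_pos (Eventually.of_forall fun _ => ⟨Real.exp_pos _, (one_mul _).ge⟩))
    (le_lyapunovExp one_pos (Eventually.of_forall fun _ => (one_mul _).le).frequently)

theorem le_lyapunovExp_of_mul_exp_le {N : ℝ → ℝ} {K l R : ℝ} (hK : 0 < K) (hR : 0 ≤ R)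
    (h : ∀ t, 0 ≤ t → K * Real.exp (l * t - logOscillation R t) ≤ N t) :
    (l : EReal) ≤ lyapunovExp N := by
  refine le_lyapunovExp hK (((frequently_logOscillation_eq_zero R hR).and_eventually
    (eventually_ge_atTop 0)).mono ?_)
  rintro t ⟨⟨h0, -⟩, ht⟩
  simpa [h0] using h t ht

theorem lyapunovExp_exp_sub_logOscillation (l : ℝ) {R : ℝ} (hR : 0 ≤ R) :
    lyapunovExp (fun t => Real.exp (l * t - logOscillation R t)) = l := by
  refine le_antisymm (lyapunovExp_le one_pos ?_)
    (le_lyapunovExp_of_mul_exp_le one_pos hR fun t _ => (one_mul _).le)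
  filter_upwards [eventually_ge_atTop 0] with t ht
  refine ⟨Real.exp_pos _, ?_⟩
  rw [one_mul, Real.exp_le_exp]
  linarith [logOscillation_nonneg hR ht]

theorem linearIndependent_cons_single {m : ℕ} (x : Fin m → ℝ) :
    LinearIndependent ℝ
      (fun k => (Fin.cons (x k) (Pi.single k 1) : Fin (m + 1) → ℝ)) := by
  rw [Fintype.linearIndependent_iff]
  intro g hg k
  simpa [Pi.single_apply] using congrFun hg k.succ

theorem linearIndependent_cons_cons_single {m : ℕ} (x : Fin m → ℝ) :
    LinearIndependent ℝ (Fin.cons (Fin.cons 1 0) fun k => Fin.cons (x k) (Pi.single k 1) :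
      Fin (m + 1) → Fin (m + 1) → ℝ) := by
  rw [linearIndependent_finCons]
  refine ⟨linearIndependent_cons_single x, fun h => ?_⟩
  obtain ⟨g, hg⟩ := (Submodule.mem_span_range_iff_exists_fun ℝ).1 h
  have hg0 : ∀ k, g k = 0 := fun k => by
    simpa [Pi.single_apply] using congrFun hg k.succ
  simpa [hg0] using congrFun hg 0

theorem mem_span_cons_single {m : ℕ} {z : Fin (m + 1) → ℝ} (hz : z 0 = 0) :
    z ∈ Submodule.span ℝ
      (Set.range fun k : Fin m => (Fin.cons 0 (Pi.single k 1) : Fin (m + 1) → ℝ)) := by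
  refine (Submodule.mem_span_range_iff_exists_fun ℝ).2 ⟨fun k => z k.succ, ?_⟩
  ext i
  refine Fin.cases ?_ (fun j => ?_) i
  · simp [hz]
  · simp [Pi.single_apply]

/-- Deterministic (pathwise) core of Theorem 2.2: the `n`-dimensional anti-Perron effect.
Given `λ_n ≥ … ≥ λ₁ > 0`, `θ > 1` and `0 < σ < (θ-1)λ₁/θ`, there are a bounded smooth
system with Lyapunov exponents `λ₁, …, λ_n` and an exponentially decaying smooth
perturbation such that the perturbed system has exactly `n-1` linearly independent
solutions with negative Lyapunov exponents `Λ₁, …, Λ_{n-1}`, and every solution linearly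
independent of them has Lyapunov exponent greater than `|Λ₁ + … + Λ_{n-1}|`. -/
theorem stmt13 (n : ℕ) (hn : 3 ≤ n) (lam : Fin n → ℝ) (hmono : Monotone lam)
    (hpos : 0 < lam ⟨0, by omega⟩) (θ σ : ℝ) (hθ : 1 < θ)
    (hσ0 : 0 < σ) (hσ : σ < (θ - 1) * lam ⟨0, by omega⟩ / θ) :
    ∃ (T₁ : ℝ) (B Q : ℝ → Matrix (Fin n) (Fin n) ℝ) (C : ℝ), 0 < C ∧
      (∀ i j, ContDiffOn ℝ (⊤ : ℕ∞) (fun t => B t i j) (Set.Ici T₁)) ∧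
      (∃ Mb : ℝ, ∀ t : ℝ, T₁ ≤ t → ∀ i j, |B t i j| ≤ Mb) ∧
      (∀ i j, ContDiffOn ℝ (⊤ : ℕ∞) (fun t => Q t i j) (Set.Ici T₁)) ∧
      (∀ t : ℝ, T₁ ≤ t → ∀ i j, |Q t i j| ≤ C * Real.exp (-σ * t)) ∧
      -- (i) the unperturbed equation has Lyapunov exponents λ₁, …, λ_n
      (∃ X : Fin n → ℝ → Fin n → ℝ,
        (∀ i, ∀ t : ℝ, T₁ ≤ t → HasDerivAt (X i) ((B t).mulVec (X i t)) t) ∧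
        LinearIndependent ℝ (fun i => X i T₁) ∧
        (∀ i, Filter.limsup (fun t : ℝ => ((1 / t * Real.log ‖X i t‖ : ℝ) : EReal))
          Filter.atTop = (lam i : EReal))) ∧
      -- (ii) and (iii) for the perturbed equation
      (∃ (Y : Fin (n - 1) → ℝ → Fin n → ℝ) (Λ : Fin (n - 1) → ℝ),
        (∀ i, ∀ t : ℝ, T₁ ≤ t → HasDerivAt (Y i) ((B t + Q t).mulVec (Y i t)) t) ∧
        LinearIndependent ℝ (fun i => Y i T₁) ∧
        (∀ i, Λ i < 0) ∧
        (∀ i, Filter.limsup (fun t : ℝ => ((1 / t * Real.log ‖Y i t‖ : ℝ) : EReal))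
          Filter.atTop = (Λ i : EReal)) ∧
        (∀ Z : ℝ → Fin n → ℝ,
          (∀ t : ℝ, T₁ ≤ t → HasDerivAt Z ((B t + Q t).mulVec (Z t)) t) →
          Z T₁ ∉ Submodule.span ℝ (Set.range fun i => Y i T₁) →
          Filter.limsup (fun t : ℝ => ((1 / t * Real.log ‖Z t‖ : ℝ) : EReal)) Filter.atTop
            > ((|∑ i, Λ i| : ℝ) : EReal))) := by
  obtain ⟨m, rfl⟩ : ∃ m, n = m + 1 := ⟨n - 1, by omega⟩
  set l := lam ⟨0, by omega⟩
  set ε := l / (2 * (m + 1)) with hεdef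
  have hε : 0 < ε := by positivity
  have hmε : m * ε < l := by
    rw [hεdef, mul_div_assoc', div_lt_iff₀ (by positivity)]
    nlinarith [(Nat.cast_nonneg m : (0 : ℝ) ≤ m)]
  set M := lam (Fin.last m)
  have hlM : l ≤ M := hmono (Fin.le_last _)
  obtain ⟨R, hR⟩ : ∃ R, R = (l + σ + ε) + Real.exp Real.pi * (M - l) := ⟨_, rfl⟩
  have hR0 : 0 ≤ R := by
    have := mul_nonneg (Real.exp_pos Real.pi).le (sub_nonneg.2 hlM)
    rw [hR]; positivity
  have hex : ∀ k : Fin m, ∃ c, l + σ + ε ≤ c ∧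
      lyapunovExp (solutionSize l ε R c) = lam k.succ := fun k =>
    exists_lyapunovExp_solutionSize_eq hpos hε (by positivity) hR
      (hmono (Fin.zero_le _)) (hmono (Fin.le_last _))
  choose c hc hclam using hex
  have hosc0 : logOscillation R 0 = 0 := by simp [logOscillation]
  let a : ℝ → ℝ := fun t => l - deriv (logOscillation R) t
  let q : ℝ → Fin m → ℝ := fun t k => Real.exp (-(c k - l - ε) * t)
  have hdiff : ContDiff ℝ (⊤ : ℕ∞) a :=
    contDiff_const.sub ((contDiff_infty_iff_deriv.1 (contDiff_logOscillation R)).2)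
  have hq : ∀ k, ContDiff ℝ (⊤ : ℕ∞) fun t => q t k := fun k =>
    (contDiff_const.mul contDiff_id).exp
  have hqle : ∀ t, 0 ≤ t → ∀ k, |q t k| ≤ Real.exp (-σ * t) := fun t ht k => by
    rw [abs_of_pos (Real.exp_pos _), Real.exp_le_exp]
    exact mul_le_mul_of_nonneg_right (by linarith [hc k]) ht
  have hsum : ∀ t, arrowMatrix (a t) ε (q t) + arrowMatrix 0 0 (-q t) =
      arrowMatrix (a t) ε 0 := fun t => by
    ext i j
    refine Fin.cases ?_ (fun i => ?_) i <;> refine Fin.cases ?_ (fun j => ?_) j <;>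
      simp [arrowMatrix]
  refine ⟨0, fun t => arrowMatrix (a t) ε (q t), fun t => arrowMatrix 0 0 (-q t), 1, one_pos,
    ?_, ⟨max (l + 4 * R) (max 1 ε), ?_⟩, ?_, ?_, ?_, ?_⟩
  · intro i j
    refine ContDiff.contDiffOn ?_
    refine Fin.cases ?_ (fun i => ?_) i <;> refine Fin.cases ?_ (fun j => ?_) j <;>
      simp only [arrowMatrix, Matrix.of_apply, Fin.cons_zero, Fin.cons_succ]
    exacts [hdiff, hq j, contDiff_const, contDiff_const]
  · intro t ht i j
    refine Fin.cases ?_ (fun i => ?_) i <;> refine Fin.cases ?_ (fun j => ?_) j <;>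
      simp only [arrowMatrix, Matrix.of_apply, Fin.cons_zero, Fin.cons_succ]
    · refine le_max_of_le_left ((abs_sub _ _).trans ?_)
      rw [abs_of_pos hpos]
      exact add_le_add_right (abs_deriv_logOscillation_le hR0 t) _
    · refine le_max_of_le_right (le_max_of_le_left ((hqle t ht j).trans ?_))
      rw [Real.exp_le_one_iff]
      nlinarith
    · rw [abs_zero]; positivity
    · refine le_max_of_le_right (le_max_of_le_right ?_)
      rw [Pi.single_apply]
      split_ifs
      · rw [abs_neg, abs_of_pos hε]
      · rw [abs_zero]; exact hε.le
  · intro i j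
    refine ContDiff.contDiffOn ?_
    refine Fin.cases ?_ (fun i => ?_) i <;> refine Fin.cases ?_ (fun j => ?_) j <;>
      simp only [arrowMatrix, Matrix.of_apply, Fin.cons_zero, Fin.cons_succ]
    exacts [contDiff_const, (hq j).neg, contDiff_const, contDiff_const]
  · intro t ht i j
    rw [one_mul]
    refine Fin.cases ?_ (fun i => ?_) i <;> refine Fin.cases ?_ (fun j => ?_) j <;>
      simp only [arrowMatrix, Matrix.of_apply, Fin.cons_zero, Fin.cons_succ, abs_zero, neg_zero,
        Pi.single_zero, Pi.zero_apply, Pi.neg_apply, abs_neg, Real.exp_nonneg]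
    exact hqle t ht j
  · refine ⟨Fin.cons (fun t => Fin.cons (Real.exp (l * t - logOscillation R t)) 0)
      fun k t => Fin.cons (Real.exp (l * t - logOscillation R t) * forcing R (c k) t)
        (Pi.single k (Real.exp (-ε * t))), ?_, ?_, ?_⟩
    · intro i t _
      refine Fin.cases ?_ (fun k => ?_) i
      · simp only [Fin.cons_zero, arrowMatrix_mulVec]
        refine hasDerivAt_cons ?_ fun k => ?_
        · simpa using hasDerivAt_exp_sub_logOscillation l R t
        · simpa using hasDerivAt_const t (0 : ℝ)
      · simp only [Fin.cons_succ, arrowMatrix_mulVec]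
        refine hasDerivAt_cons ?_ fun j => hasDerivAt_single_exp k j ε t
        refine ((hasDerivAt_exp_sub_logOscillation l R t).mul
          (hasDerivAt_forcing R (c k) t)).congr_deriv ?_
        have h1 : q t k * Real.exp (-ε * t) = Real.exp (l * t - logOscillation R t) *
            Real.exp (logOscillation R t - c k * t) := by
          rw [← Real.exp_add, ← Real.exp_add]; congr 1; ring
        rw [← h1]
        simp [Pi.single_apply, a, mul_assoc]
    · convert linearIndependent_cons_cons_single (fun k => forcing R (c k) 0) using 1
      ext i j
      refine Fin.cases ?_ (fun k => ?_) i <;> simp [hosc0]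
    · intro i
      refine Fin.cases ?_ (fun k => ?_) i
      · refine Eq.trans ?_ (lyapunovExp_exp_sub_logOscillation l hR0)
        refine congrArg lyapunovExp (funext fun t => ?_)
        rw [Fin.cons_zero, ← Pi.single_zero ⟨0, by omega⟩, norm_cons_single, abs_zero,
          abs_of_pos (Real.exp_pos _), max_eq_right (Real.exp_pos _).le]
      · refine Eq.trans ?_ (hclam k)
        refine limsup_congr ?_
        filter_upwards [eventually_ge_atTop 0] with t ht
        rw [Fin.cons_succ, norm_cons_single, solutionSize, abs_of_nonneg ht,
          abs_of_pos (Real.exp_pos _), abs_of_nonneg (mul_nonneg (Real.exp_pos _).le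
            (zero_le_one.trans (one_le_forcing ht)))]
  · refine ⟨fun k t => Fin.cons 0 (Pi.single k (Real.exp (-ε * t))), fun _ => -ε, ?_, ?_,
      fun _ => neg_lt_zero.2 hε, ?_, ?_⟩
    · intro k t _
      rw [hsum, arrowMatrix_mulVec]
      refine hasDerivAt_cons ?_ fun j => hasDerivAt_single_exp k j ε t
      simpa using hasDerivAt_const t (0 : ℝ)
    · simpa using linearIndependent_cons_single (0 : Fin m → ℝ)
    · intro k
      refine Eq.trans ?_ (lyapunovExp_exp (-ε))
      refine congrArg lyapunovExp (funext fun t => ?_)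
      refine (norm_cons_single _ _ _).trans ?_
      rw [abs_zero, abs_of_pos (Real.exp_pos _), max_eq_left (Real.exp_pos _).le]
    · intro Z hZ hspan
      have hZ0 : Z 0 0 ≠ 0 := fun h => hspan (by simpa using mem_span_cons_single h)
      have hZd : ∀ t, 0 ≤ t → HasDerivAt (fun t => Z t 0) (a t * Z t 0) t := fun t ht => by
        have h := hasDerivAt_pi.1 (hZ t ht) 0
        rw [hsum, ← Fin.cons_self_tail (Z t), arrowMatrix_mulVec] at h
        simpa using h
      have hle : (l : EReal) ≤ lyapunovExp fun t => ‖Z t‖ := by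
        refine le_lyapunovExp_of_mul_exp_le (abs_pos.2 hZ0) hR0 fun t ht => ?_
        have h := norm_le_pi_norm (Z t) 0
        rwa [eq_mul_exp_of_hasDerivAt hZd ht, norm_mul, Real.norm_eq_abs, Real.norm_eq_abs,
          abs_of_pos (Real.exp_pos _)] at h
      refine lt_of_lt_of_le (EReal.coe_lt_coe_iff.2 ?_) hle
      simpa [abs_of_pos hε] using hmε
end

section
/- For any real numbers λ₂ ≤ λ₁ < 0 and any θ > 1, there exist t₀ > 0, a bounded C^∞ matrix function B : [t₀, ∞) → Mat₂(ℝ) whose equation Y′ = B(t)Y has two linearly independent solutions with Lyapunov exponents λ₁ and λ₂, and a constant h > 0 (depending on λ₁, λ₂, θ) such that for every σ ∈ (0, h) there is a C^∞ matrix function Q : [t₀, ∞) → Mat₂(ℝ) with ‖Q(t)‖ ≤ C e^{−σt} for all t ≥ t₀ (for some C > 0) for which the perturbed equation Y′ = (B(t) + Q(t))Y has a nontrivial solution with positive Lyapunov exponent. -/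
open Filter

open Real in
/-- `t ↦ t * (a + M * (sin (log t) - 1))`, an integrated diagonal coefficient whose average
oscillates on the logarithmic scale between `a - 2 * M` and `a`. -/
noncomputable def logOsc (a M t : ℝ) : ℝ := t * (a + M * (sin (log t) - 1))

/-- The derivative of `logOsc a M` on the positive half-line. -/
noncomputable def logOscDeriv (a M t : ℝ) : ℝ :=
  a + M * (Real.sin (Real.log t) - 1) + M * Real.cos (Real.log t)

lemma hasDerivAt_logOsc (a M : ℝ) {t : ℝ} (ht : 0 < t) :
    HasDerivAt (logOsc a M) (logOscDeriv a M t) t := by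
  have h := (hasDerivAt_id t).mul
    ((((Real.hasDerivAt_log ht.ne').sin.sub_const 1).const_mul M).const_add a)
  refine h.congr_deriv ?_
  simp only [id, logOscDeriv]
  field_simp

lemma contDiffOn_logOscDeriv (a M : ℝ) :
    ContDiffOn ℝ (⊤ : ℕ∞) (logOscDeriv a M) (Set.Ici 1) := by
  have hlog : ContDiffOn ℝ (⊤ : ℕ∞) Real.log (Set.Ici 1) :=
    Real.contDiffOn_log.mono fun t ht => by
      have : (1 : ℝ) ≤ t := ht
      simp only [Set.mem_compl_iff, Set.mem_singleton_iff]
      linarith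
  exact (contDiffOn_const.add (contDiffOn_const.mul (hlog.sin.sub contDiffOn_const))).add
    (contDiffOn_const.mul hlog.cos)

lemma abs_logOscDeriv_le (a M t : ℝ) : |logOscDeriv a M t| ≤ |a| + 3 * |M| := by
  have h : |Real.sin (Real.log t) - 1 + Real.cos (Real.log t)| ≤ 3 := by
    rw [abs_le]
    constructor <;> linarith [Real.neg_one_le_sin (Real.log t), Real.sin_le_one (Real.log t),
      Real.neg_one_le_cos (Real.log t), Real.cos_le_one (Real.log t)]
  calc |logOscDeriv a M t|
      = |a + M * (Real.sin (Real.log t) - 1 + Real.cos (Real.log t))| := by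
        rw [logOscDeriv]; ring_nf
    _ ≤ |a| + |M| * |Real.sin (Real.log t) - 1 + Real.cos (Real.log t)| := by
        rw [← abs_mul]; exact abs_add_le _ _
    _ ≤ |a| + 3 * |M| := by nlinarith [abs_nonneg M]

lemma logOsc_le (a : ℝ) {M t : ℝ} (hM : 0 ≤ M) (ht : 0 ≤ t) : logOsc a M t ≤ t * a := by
  refine mul_le_mul_of_nonneg_left ?_ ht
  nlinarith [Real.sin_le_one (Real.log t)]

/-- Times at which `sin ∘ log` equals `1`. -/
noncomputable def peakTime (n : ℕ) : ℝ := Real.exp (Real.pi / 2 + n * (2 * Real.pi))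

lemma peakTime_pos (n : ℕ) : 0 < peakTime n := Real.exp_pos _

lemma tendsto_peakTime : Tendsto peakTime atTop atTop :=
  Real.tendsto_exp_atTop.comp <| tendsto_atTop_add_const_left _ _ <|
    tendsto_natCast_atTop_atTop.atTop_mul_const Real.two_pi_pos

lemma logOsc_peakTime (a M : ℝ) (n : ℕ) : logOsc a M (peakTime n) = peakTime n * a := by
  simp [logOsc, peakTime, Real.sin_add_nat_mul_two_pi]

/-- On the half-period before a peak time on which `sin ∘ log` is nonpositive,
`logOsc a M` is at most `t * (a - M)`. -/
lemma logOsc_le_of_half_period (a : ℝ) {M t : ℝ} (hM : 0 ≤ M) (n : ℕ)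
    (ht₁ : Real.exp (-Real.pi + n * (2 * Real.pi)) ≤ t)
    (ht₂ : t ≤ Real.exp (n * (2 * Real.pi))) :
    logOsc a M t ≤ t * (a - M) := by
  have ht : 0 < t := (Real.exp_pos _).trans_le ht₁
  have h₁ := (Real.le_log_iff_exp_le ht).2 ht₁
  have h₂ := (Real.log_le_iff_le_exp ht).2 ht₂
  have h := Real.sin_nonpos_of_nonpos_of_neg_pi_le (x := Real.log t - n * (2 * Real.pi))
    (by linarith) (by linarith)
  rw [Real.sin_sub_nat_mul_two_pi] at h
  refine mul_le_mul_of_nonneg_left ?_ ht.le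
  nlinarith

/-- `∫₁ᵗ exp (c * s - logOsc a M s) ds`, the variation-of-constants integral. -/
noncomputable def oscIntegral (c a M t : ℝ) : ℝ :=
  ∫ s in (1 : ℝ)..t, Real.exp (c * s - logOsc a M s)

lemma hasDerivAt_oscIntegral (c a M : ℝ) {t : ℝ} (ht : 0 < t) :
    HasDerivAt (oscIntegral c a M) (Real.exp (c * t - logOsc a M t)) t := by
  have hcont : ∀ s : ℝ, 0 < s → ContinuousAt (fun s => Real.exp (c * s - logOsc a M s)) s :=
    fun s hs => ((continuousAt_const.mul continuousAt_id).sub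
      (hasDerivAt_logOsc a M hs).continuousAt).rexp
  have hmeas : Measurable fun s => Real.exp (c * s - logOsc a M s) := by
    unfold logOsc
    fun_prop
  refine intervalIntegral.integral_hasDerivAt_right ?_
    hmeas.stronglyMeasurable.stronglyMeasurableAtFilter (hcont t ht)
  refine ContinuousOn.intervalIntegrable fun s hs => (hcont s ?_).continuousWithinAt
  exact (lt_min one_pos ht).trans_le hs.1

lemma monotoneOn_oscIntegral (c a M : ℝ) : MonotoneOn (oscIntegral c a M) (Set.Ioi 0) := by
  refine monotoneOn_of_hasDerivWithinAt_nonneg (convex_Ioi 0)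
    (f' := fun t => Real.exp (c * t - logOsc a M t))
    (fun t ht => (hasDerivAt_oscIntegral c a M ht).continuousAt.continuousWithinAt)
    (fun t ht => (hasDerivAt_oscIntegral c a M (interior_subset ht)).hasDerivWithinAt)
    (fun t _ => (Real.exp_pos _).le)

/-- Up to a peak time, `oscIntegral` collects at least the contribution of a unit interval at the
start of the half-period on which `logOsc a M` is at most `t * (a - M)`. -/
lemma exp_le_oscIntegral_peakTime {c a M : ℝ} (hM : 0 ≤ M) (hc : 0 ≤ c - a + M) {n : ℕ}
    (hn : 1 ≤ n) :
    Real.exp ((c - a + M) * (peakTime n * Real.exp (-(3 * Real.pi / 2))))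
      ≤ oscIntegral c a M (peakTime n) := by
  set r := Real.exp (-Real.pi + n * (2 * Real.pi)) with hr
  have hn' : (1 : ℝ) ≤ n := by exact_mod_cast hn
  have hpi := Real.pi_gt_three
  have hr₁ : 1 ≤ r := Real.one_le_exp (by nlinarith)
  have hr₂ : r + 1 ≤ Real.exp (n * (2 * Real.pi)) := by
    have h : Real.exp (n * (2 * Real.pi)) = r * Real.exp Real.pi := by
      rw [hr, ← Real.exp_add]; ring_nf
    rw [h]
    nlinarith [Real.add_one_le_exp Real.pi]
  have hpeak : peakTime n * Real.exp (-(3 * Real.pi / 2)) = r := by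
    rw [peakTime, hr, ← Real.exp_add]; ring_nf
  have hr₃ : r + 1 ≤ peakTime n :=
    hr₂.trans (Real.exp_le_exp.2 (by linarith))
  obtain ⟨s, hs, hslope⟩ := exists_hasDerivAt_eq_slope (oscIntegral c a M)
    (fun t => Real.exp (c * t - logOsc a M t)) (lt_add_one r)
    (fun t ht => (hasDerivAt_oscIntegral c a M
      (by linarith [ht.1])).continuousAt.continuousWithinAt)
    (fun t ht => hasDerivAt_oscIntegral c a M (by linarith [ht.1]))
  have hmono := monotoneOn_oscIntegral c a M
  have h₀ : 0 ≤ oscIntegral c a M r := by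
    have h := hmono (Set.mem_Ioi.2 one_pos) (Set.mem_Ioi.2 (by linarith)) hr₁
    simpa [oscIntegral] using h
  have h₁ : oscIntegral c a M (r + 1) ≤ oscIntegral c a M (peakTime n) :=
    hmono (Set.mem_Ioi.2 (by linarith)) (Set.mem_Ioi.2 (by linarith)) hr₃
  have h₂ : Real.exp ((c - a + M) * r) ≤ Real.exp (c * s - logOsc a M s) := by
    refine Real.exp_le_exp.2 ?_
    have := logOsc_le_of_half_period a hM n hs.1.le (hs.2.le.trans hr₂)
    nlinarith [mul_le_mul_of_nonneg_left hs.1.le hc]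
  rw [add_sub_cancel_left, div_one] at hslope
  rw [hpeak]
  linarith

lemma limsup_lyapunov_eq_of_log_norm_eq {X : ℝ → Fin 2 → ℝ} {a : ℝ}
    (h : ∀ t, Real.log ‖X t‖ = a * t) :
    limsup (fun t : ℝ => ((1 / t * Real.log ‖X t‖ : ℝ) : EReal)) atTop = (a : EReal) := by
  refine (limsup_congr ?_).trans (limsup_const _)
  filter_upwards [eventually_gt_atTop 0] with t ht
  rw [h t]
  congr 1
  field_simp

lemma limsup_lyapunov_eq_of_log_norm_eq_logOsc {X : ℝ → Fin 2 → ℝ} {a M : ℝ} (hM : 0 ≤ M)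
    (h : ∀ t, Real.log ‖X t‖ = logOsc a M t) :
    limsup (fun t : ℝ => ((1 / t * Real.log ‖X t‖ : ℝ) : EReal)) atTop = (a : EReal) := by
  refine le_antisymm (limsup_le_of_le (by isBoundedDefault) ?_)
    (le_limsup_of_frequently_le ?_ (by isBoundedDefault))
  · filter_upwards [eventually_gt_atTop 0] with t ht
    rw [h t, EReal.coe_le_coe_iff, one_div, inv_mul_le_iff₀ ht]
    exact logOsc_le a hM ht.le
  · refine tendsto_peakTime.frequently (Frequently.of_forall fun n => ?_)
    rw [h, logOsc_peakTime, EReal.coe_le_coe_iff, one_div,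
      inv_mul_cancel_left₀ (peakTime_pos n).ne']



/-- Deterministic (pathwise) core of Theorem 2.3 (Perron-type effect): a bounded smooth
planar system with negative Lyapunov exponents `λ₂ ≤ λ₁ < 0` can be destabilized by an
exponentially decaying smooth perturbation, for every decay rate `σ ∈ (0, h)`. -/
theorem stmt14 (lam1 lam2 θ : ℝ) (hlam1 : lam1 < 0) (hlam21 : lam2 ≤ lam1) (hθ : 1 < θ) :
    ∃ t₀ : ℝ, 0 < t₀ ∧ ∃ B : ℝ → Matrix (Fin 2) (Fin 2) ℝ,
      (∀ i j, ContDiffOn ℝ (⊤ : ℕ∞) (fun t => B t i j) (Set.Ici t₀)) ∧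
      (∃ Mb : ℝ, ∀ t : ℝ, t₀ ≤ t → ∀ i j, |B t i j| ≤ Mb) ∧
      -- the unperturbed equation has Lyapunov exponents λ₁ and λ₂
      (∃ X₁ X₂ : ℝ → Fin 2 → ℝ,
        (∀ t : ℝ, t₀ ≤ t → HasDerivAt X₁ ((B t).mulVec (X₁ t)) t) ∧
        (∀ t : ℝ, t₀ ≤ t → HasDerivAt X₂ ((B t).mulVec (X₂ t)) t) ∧
        LinearIndependent ℝ ![X₁ t₀, X₂ t₀] ∧
        Filter.limsup (fun t : ℝ => ((1 / t * Real.log ‖X₁ t‖ : ℝ) : EReal)) Filter.atTop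
          = (lam1 : EReal) ∧
        Filter.limsup (fun t : ℝ => ((1 / t * Real.log ‖X₂ t‖ : ℝ) : EReal)) Filter.atTop
          = (lam2 : EReal)) ∧
      -- for each σ ∈ (0, h) there is a perturbation producing a growing solution
      (∃ h : ℝ, 0 < h ∧ ∀ σ ∈ Set.Ioo (0:ℝ) h,
        ∃ (Q : ℝ → Matrix (Fin 2) (Fin 2) ℝ) (C : ℝ), 0 < C ∧
          (∀ i j, ContDiffOn ℝ (⊤ : ℕ∞) (fun t => Q t i j) (Set.Ici t₀)) ∧
          (∀ t : ℝ, t₀ ≤ t → ∀ i j, |Q t i j| ≤ C * Real.exp (-σ * t)) ∧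
          (∃ Y : ℝ → Fin 2 → ℝ, Y t₀ ≠ 0 ∧
            (∀ t : ℝ, t₀ ≤ t → HasDerivAt Y ((B t + Q t).mulVec (Y t)) t) ∧
            Filter.limsup (fun t : ℝ => ((1 / t * Real.log ‖Y t‖ : ℝ) : EReal))
              Filter.atTop > 0)) := by
  set K := Real.exp (-(3 * Real.pi / 2)) with hK
  have hKpos : 0 < K := Real.exp_pos _
  set M := 2 - lam1 - lam2 / K with hMdef
  have hlam2 : lam2 < 0 := hlam21.trans_lt hlam1
  have hM : 0 ≤ M := by
    have := div_neg_of_neg_of_pos hlam2 hKpos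
    linarith
  have hexp : ∀ t : ℝ, HasDerivAt (fun t => Real.exp (lam1 * t)) (lam1 * Real.exp (lam1 * t)) t :=
    fun t => (((hasDerivAt_id t).const_mul lam1).exp).congr_deriv (by simp; ring)
  have hosc : ∀ t : ℝ, 1 ≤ t → HasDerivAt (fun t => Real.exp (logOsc lam2 M t))
      (logOscDeriv lam2 M t * Real.exp (logOsc lam2 M t)) t := fun t ht =>
    ((hasDerivAt_logOsc lam2 M (by linarith)).exp).congr_deriv (by ring)
  refine ⟨1, one_pos, fun t => !![lam1, 0; 0, logOscDeriv lam2 M t], ?_, ?_, ?_, 1, one_pos, ?_⟩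
  · intro i j
    fin_cases i <;> fin_cases j <;>
      first
        | exact contDiffOn_const
        | exact contDiffOn_logOscDeriv lam2 M
  · refine ⟨|lam1| + (|lam2| + 3 * |M|), fun t _ i j => ?_⟩
    have h := abs_logOscDeriv_le lam2 M t
    have h₁ := abs_nonneg lam1
    have h₂ := abs_nonneg (logOscDeriv lam2 M t)
    fin_cases i <;> fin_cases j <;> simp <;> linarith
  · refine ⟨fun t => ![Real.exp (lam1 * t), 0], fun t => ![0, Real.exp (logOsc lam2 M t)],
      ?_, ?_, ?_, limsup_lyapunov_eq_of_log_norm_eq fun t => ?_,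
      limsup_lyapunov_eq_of_log_norm_eq_logOsc hM fun t => ?_⟩
    · intro t _
      rw [hasDerivAt_pi]
      intro i
      fin_cases i
      · simpa [Matrix.mulVec, dotProduct] using hexp t
      · simpa [Matrix.mulVec, dotProduct] using hasDerivAt_const t (0 : ℝ)
    · intro t ht
      rw [hasDerivAt_pi]
      intro i
      fin_cases i
      · simpa [Matrix.mulVec, dotProduct] using hasDerivAt_const t (0 : ℝ)
      · simpa [Matrix.mulVec, dotProduct] using hosc t ht
    · rw [LinearIndependent.pair_iff]
      intro x y hxy
      have h₀ := congrFun hxy 0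
      have h₁ := congrFun hxy 1
      simpa using And.intro h₀ h₁
    · simp [Pi.norm_def, Fin.univ_succ]
    · simp [Pi.norm_def, Fin.univ_succ]
  · rintro σ ⟨hσ₀, hσ₁⟩
    refine ⟨fun t => !![0, 0; Real.exp (-σ * t), 0], 1, one_pos, ?_, ?_,
      fun t => ![Real.exp (lam1 * t),
        Real.exp (logOsc lam2 M t) * oscIntegral (lam1 - σ) lam2 M t], ?_, ?_, ?_⟩
    · intro i j
      fin_cases i <;> fin_cases j <;>
        first
          | exact contDiffOn_const
          | exact (contDiff_const.mul contDiff_id).exp.contDiffOn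
    · intro t _ i j
      fin_cases i <;> fin_cases j <;> simp [(Real.exp_pos _).le]
    · intro h
      exact (Real.exp_pos _).ne' (congrFun h 0)
    · intro t ht
      rw [hasDerivAt_pi]
      intro i
      fin_cases i
      · simpa [Matrix.mulVec, dotProduct] using hexp t
      · have h := (hosc t ht).mul
          (hasDerivAt_oscIntegral (lam1 - σ) lam2 M (zero_lt_one.trans_le ht))
        have hcoef : Real.exp (logOsc lam2 M t) * Real.exp ((lam1 - σ) * t - logOsc lam2 M t)
            = Real.exp (-σ * t) * Real.exp (lam1 * t) := by
          rw [← Real.exp_add, ← Real.exp_add]; ring_nf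
        refine h.congr_deriv ?_
        rw [hcoef]
        simp [Matrix.mulVec, dotProduct]
        ring
    · refine lt_of_lt_of_le (EReal.coe_pos.2 hKpos)
        (le_limsup_of_frequently_le ?_ (by isBoundedDefault))
      refine tendsto_peakTime.frequently (Eventually.frequently ?_)
      filter_upwards [eventually_ge_atTop 1] with n hn
      have hT := peakTime_pos n
      have hdiv : lam2 / K * K = lam2 := div_mul_cancel₀ _ hKpos.ne'
      have hdiv_neg := div_neg_of_neg_of_pos hlam2 hKpos
      have hF := exp_le_oscIntegral_peakTime (c := lam1 - σ) (a := lam2) hM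
        (by linarith) hn
      rw [← hK] at hF
      rw [EReal.coe_le_coe_iff, one_div, le_inv_mul_iff₀ hT, Real.le_log_iff_exp_le]
      · calc Real.exp (peakTime n * K)
            ≤ Real.exp (logOsc lam2 M (peakTime n)
                + (lam1 - σ - lam2 + M) * (peakTime n * K)) := by
              refine Real.exp_le_exp.2 ?_
              rw [logOsc_peakTime]
              have : peakTime n * lam2 + (lam1 - σ - lam2 + M) * (peakTime n * K)
                  = (2 - σ - lam2) * (peakTime n * K) := by
                rw [hMdef]
                linear_combination (-peakTime n) * hdiv
              rw [this]
              nlinarith [mul_pos hT hKpos]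
          _ ≤ Real.exp (logOsc lam2 M (peakTime n))
                * oscIntegral (lam1 - σ) lam2 M (peakTime n) := by
              rw [Real.exp_add]
              exact mul_le_mul_of_nonneg_left hF (Real.exp_pos _).le
          _ ≤ _ := (le_abs_self _).trans (norm_le_pi_norm
              (![Real.exp (lam1 * peakTime n), Real.exp (logOsc lam2 M (peakTime n))
                * oscIntegral (lam1 - σ) lam2 M (peakTime n)] : Fin 2 → ℝ) 1)
      · rw [norm_pos_iff]
        intro h
        exact (Real.exp_pos _).ne' (congrFun h 0)
end

section
/- Let θ > 1, p₂ > p₁ > 0 and α₂ > 0. Set t₀ = p₁ + p₂, t_{2k} = (p₁ + p₂)θ^k, and t_{2k−1} = t_{2k−2} + p₂(θ^k − θ^{k−1}) for k ≥ 1, and define a : [t₀, ∞) → ℝ by a(t) = −α₂ for t ∈ [t_{2k−2}, t_{2k−1}) and a(t) = α₂ for t ∈ [t_{2k−1}, t_{2k}). Then limsup_{t→∞} (1/t) ∫_{t₀}^t a(τ) dτ = ((p₁ − p₂)/(p₁ + p₂)) α₂. -/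
open Filter Set

open MeasureTheory in
/-- A function constant on `[x, y)` is interval integrable there, with the expected integral. -/
lemma integral_of_const_on_Ico {f : ℝ → ℝ} {x y c : ℝ} (hxy : x ≤ y)
    (h : ∀ t ∈ Set.Ico x y, f t = c) :
    IntervalIntegrable f volume x y ∧ ∫ τ in x..y, f τ = c * (y - x) := by
  have h' : ∀ t ∈ Set.Ioo x y, f t = c := fun t ht => h t ⟨ht.1.le, ht.2⟩
  constructor
  · rw [intervalIntegrable_iff_integrableOn_Ioo_of_le hxy]
    refine IntegrableOn.congr_fun (f := fun _ => c) ?_ (fun t ht => (h' t ht).symm)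
      measurableSet_Ioo
    exact integrableOn_const (by simp)
  · rw [intervalIntegral.integral_of_le hxy, integral_Ioc_eq_integral_Ioo,
      setIntegral_congr_fun measurableSet_Ioo h', ← integral_Ioc_eq_integral_Ioo,
      ← intervalIntegral.integral_of_le hxy, intervalIntegral.integral_const, smul_eq_mul,
      mul_comm]

/-- Extending an integral across `[x, y)`, where the integrand is constant. -/
lemma integral_extend_of_const_on_Ico {f : ℝ → ℝ} {s x y c : ℝ} (hxy : x ≤ y)
    (hs : IntervalIntegrable f MeasureTheory.volume s x) (h : ∀ t ∈ Set.Ico x y, f t = c) :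
    IntervalIntegrable f MeasureTheory.volume s y ∧
      ∫ τ in s..y, f τ = (∫ τ in s..x, f τ) + c * (y - x) := by
  obtain ⟨hi, he⟩ := integral_of_const_on_Ico hxy h
  exact ⟨hs.trans hi, by rw [← intervalIntegral.integral_add_adjacent_intervals hs hi, he]⟩

/-- If `F t ≤ c t + C` eventually, with `c t ≤ F t` for arbitrarily large `t`, then
`limsup F t / t = c`. -/
lemma limsup_div_eq_of_le_affine {F : ℝ → ℝ} {c C : ℝ}
    (hle : ∀ᶠ t in atTop, F t ≤ c * t + C) (hge : ∃ᶠ t in atTop, c * t ≤ F t) :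
    limsup (fun t : ℝ => (1 / t) * F t) atTop = c := by
  have hlim : Tendsto (fun t : ℝ => c + C / t) atTop (nhds c) := by
    simpa using (tendsto_const_nhds (x := c)).add (tendsto_const_nhds.div_atTop tendsto_id)
  have hle' : (fun t : ℝ => (1 / t) * F t) ≤ᶠ[atTop] fun t => c + C / t := by
    filter_upwards [hle, eventually_gt_atTop 0] with t ht h0
    calc (1 / t) * F t ≤ (1 / t) * (c * t + C) := by gcongr
      _ = c + C / t := by field_simp
  have hge' : ∃ᶠ t : ℝ in atTop, c ≤ (1 / t) * F t := by
    refine (hge.and_eventually (eventually_gt_atTop 0)).mono fun t ht => ?_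
    rw [one_div, inv_mul_eq_div, le_div_iff₀ ht.2]
    exact ht.1
  apply le_antisymm
  · rw [← hlim.limsup_eq]
    exact limsup_le_limsup hle' (IsCoboundedUnder.of_frequently_ge hge') hlim.isBoundedUnder_le
  · exact le_limsup_of_frequently_le hge' (hlim.isBoundedUnder_le.mono_le hle')

/-- A drift coefficient equal to `-α₂` on `[t_{2k-2}, t_{2k-1})` and `α₂` on
`[t_{2k-1}, t_{2k})`, where `t_{2k} = (p₁+p₂)θ^k` and
`t_{2k-1} = t_{2k-2} + p₂(θ^k - θ^{k-1})`, has average growth rate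
`((p₁-p₂)/(p₁+p₂)) α₂`. -/
theorem stmt15 (θ p₁ p₂ α₂ : ℝ) (hθ : 1 < θ) (hp₁ : 0 < p₁) (hp : p₁ < p₂) (hα : 0 < α₂)
    (a : ℝ → ℝ)
    (ha1 : ∀ k : ℕ, 1 ≤ k → ∀ t ∈ Set.Ico ((p₁ + p₂) * θ ^ (k - 1))
      ((p₁ + p₂) * θ ^ (k - 1) + p₂ * (θ ^ k - θ ^ (k - 1))), a t = -α₂)
    (ha2 : ∀ k : ℕ, 1 ≤ k → ∀ t ∈ Set.Ico
      ((p₁ + p₂) * θ ^ (k - 1) + p₂ * (θ ^ k - θ ^ (k - 1))) ((p₁ + p₂) * θ ^ k),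
      a t = α₂) :
    Filter.limsup (fun t : ℝ => (1 / t) * ∫ τ in (p₁ + p₂)..t, a τ) Filter.atTop
      = (p₁ - p₂) / (p₁ + p₂) * α₂ := by
  have hP : 0 < p₁ + p₂ := by linarith
  have hmono : ∀ k : ℕ, θ ^ k < θ ^ (k + 1) := fun k => pow_lt_pow_right₀ hθ k.lt_succ_self
  have hfirst : ∀ k : ℕ, ∀ t ∈ Set.Ico ((p₁ + p₂) * θ ^ k)
      ((p₁ + p₂) * θ ^ k + p₂ * (θ ^ (k + 1) - θ ^ k)), a t = -α₂ :=
    fun k => ha1 (k + 1) (by omega)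
  have hsecond : ∀ k : ℕ, ∀ t ∈ Set.Ico
      ((p₁ + p₂) * θ ^ k + p₂ * (θ ^ (k + 1) - θ ^ k)) ((p₁ + p₂) * θ ^ (k + 1)),
      a t = α₂ := fun k => ha2 (k + 1) (by omega)
  clear ha1 ha2
  have hnode : ∀ k : ℕ,
      IntervalIntegrable a MeasureTheory.volume (p₁ + p₂) ((p₁ + p₂) * θ ^ k) ∧
      ∫ τ in (p₁ + p₂)..((p₁ + p₂) * θ ^ k), a τ = (p₁ - p₂) * α₂ * (θ ^ k - 1) := by
    intro k
    induction k with
    | zero => simp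
    | succ k ih =>
      have h1 : 0 < p₁ * (θ ^ (k + 1) - θ ^ k) := mul_pos hp₁ (sub_pos.2 (hmono k))
      have h2 : 0 < p₂ * (θ ^ (k + 1) - θ ^ k) :=
        mul_pos (hp₁.trans hp) (sub_pos.2 (hmono k))
      obtain ⟨i1, e1⟩ := integral_extend_of_const_on_Ico (by linarith) ih.1 (hfirst k)
      obtain ⟨i2, e2⟩ := integral_extend_of_const_on_Ico (by linarith) i1 (hsecond k)
      refine ⟨i2, ?_⟩
      rw [e2, e1, ih.2]
      ring
  set c := (p₁ - p₂) / (p₁ + p₂) * α₂ with hc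
  have hcP : c * (p₁ + p₂) = (p₁ - p₂) * α₂ := by rw [hc]; field_simp
  have hc_lower : -α₂ ≤ c := by
    refine le_of_mul_le_mul_right ?_ hP
    rw [hcP]
    linarith [mul_pos hp₁ hα]
  have hc_upper : c ≤ α₂ := by
    refine le_of_mul_le_mul_right ?_ hP
    rw [hcP]
    linarith [mul_pos (hp₁.trans hp) hα]
  have hnode_affine : ∀ k : ℕ, ∫ τ in (p₁ + p₂)..((p₁ + p₂) * θ ^ k), a τ
      = c * ((p₁ + p₂) * θ ^ k) + (p₂ - p₁) * α₂ := by
    intro k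
    rw [(hnode k).2, ← mul_assoc, hcP]
    ring
  refine limsup_div_eq_of_le_affine (C := (p₂ - p₁) * α₂) ?_ ?_
  · filter_upwards [eventually_ge_atTop (p₁ + p₂)] with t ht
    obtain ⟨k, hk, hk'⟩ := exists_nat_pow_near ((one_le_div hP).2 ht) hθ
    rw [le_div_iff₀' hP] at hk
    rw [div_lt_iff₀' hP] at hk'
    have h2 : 0 < p₂ * (θ ^ (k + 1) - θ ^ k) :=
      mul_pos (hp₁.trans hp) (sub_pos.2 (hmono k))
    rcases le_total t ((p₁ + p₂) * θ ^ k + p₂ * (θ ^ (k + 1) - θ ^ k)) with htm | htm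
    · have e := (integral_extend_of_const_on_Ico hk (hnode k).1
        fun s hs => hfirst k s ⟨hs.1, hs.2.trans_le htm⟩).2
      rw [e, hnode_affine]
      linarith [mul_le_mul_of_nonneg_right hc_lower (sub_nonneg.2 hk)]
    · have i1 := (integral_extend_of_const_on_Ico (by linarith) (hnode k).1 (hfirst k)).1
      have i2 := (integral_extend_of_const_on_Ico htm i1
        fun s hs => hsecond k s ⟨hs.1, hs.2.trans hk'⟩).1
      have e := (integral_extend_of_const_on_Ico hk'.le i2
        fun s hs => hsecond k s ⟨htm.trans hs.1, hs.2⟩).2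
      rw [hnode_affine] at e
      linarith [mul_le_mul_of_nonneg_right hc_upper (sub_nonneg.2 hk'.le)]
  · have htend : Tendsto (fun k : ℕ => (p₁ + p₂) * θ ^ k) atTop atTop :=
      (tendsto_pow_atTop_atTop_of_one_lt hθ).const_mul_atTop hP
    refine htend.frequently (Frequently.of_forall fun k => ?_)
    rw [hnode_affine]
    linarith [mul_pos (sub_pos.2 hp) hα]
end

section
/- For any real numbers λ₂ ≤ λ₁ < 0 and any θ > 1, there exist real numbers p₂ > p₁ > 0 and α₁, α₂, β > 0 such that λ₁ = −α₁ − β²/2, λ₂ = ((p₁ − p₂)/(p₁ + p₂)) α₂ − β²/2, (p₂ − p₁)/p₁ < (α₁ + α₂)/(θ α₂), and (θ−1) p₁ α₁ / ( θ (p₂ − p₁) ) > α₁ + β²/2. -/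
/-- Parameter choices for the construction of Theorem 2.3: prescribed negative Lyapunov
exponents `λ₂ ≤ λ₁ < 0` can be realized with parameters `p₂ > p₁ > 0`, `α₁, α₂, β > 0`
satisfying the two additional inequalities needed for the perturbation argument. -/
theorem stmt16 (lam1 lam2 θ : ℝ) (hlam1 : lam1 < 0) (hlam21 : lam2 ≤ lam1) (hθ : 1 < θ) :
    ∃ p₁ p₂ α₁ α₂ β : ℝ, 0 < p₁ ∧ p₁ < p₂ ∧ 0 < α₁ ∧ 0 < α₂ ∧ 0 < β ∧
      lam1 = -α₁ - β ^ 2 / 2 ∧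
      lam2 = (p₁ - p₂) / (p₁ + p₂) * α₂ - β ^ 2 / 2 ∧
      (p₂ - p₁) / p₁ < (α₁ + α₂) / (θ * α₂) ∧
      (θ - 1) * p₁ * α₁ / (θ * (p₂ - p₁)) > α₁ + β ^ 2 / 2 := by
  have hθ1 : 0 < θ - 1 := by linarith
  have hθ0 : 0 < θ := by linarith
  have hc : 0 < lam1 / 2 - lam2 := by linarith
  have hS : 0 < 8 * θ ^ 2 + (θ - 1) := by positivity
  have hα₂ : 0 < (lam1 / 2 - lam2) * (8 * θ ^ 2 + (θ - 1)) / (θ - 1) := by positivity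
  have hβ : √(-lam1) ^ 2 = -lam1 := Real.sq_sqrt (by linarith)
  refine ⟨4 * θ ^ 2, 4 * θ ^ 2 + (θ - 1), -lam1 / 2,
    (lam1 / 2 - lam2) * (8 * θ ^ 2 + (θ - 1)) / (θ - 1), √(-lam1), by positivity, by linarith,
    by linarith, hα₂, Real.sqrt_pos.2 (by linarith), by rw [hβ]; ring, ?_, ?_, ?_⟩
  · have hsum : 4 * θ ^ 2 + (4 * θ ^ 2 + (θ - 1)) = 8 * θ ^ 2 + (θ - 1) := by ring
    rw [hβ, hsum]
    field_simp
    ring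
  · generalize (lam1 / 2 - lam2) * (8 * θ ^ 2 + (θ - 1)) / (θ - 1) = α₂ at hα₂
    calc (4 * θ ^ 2 + (θ - 1) - 4 * θ ^ 2) / (4 * θ ^ 2) < 1 / θ := by
          rw [div_lt_div_iff₀ (by positivity) hθ0]
          nlinarith
      _ < (-lam1 / 2 + α₂) / (θ * α₂) := by
          rw [div_lt_div_iff₀ hθ0 (by positivity)]
          nlinarith
  · have h : (θ - 1) * (4 * θ ^ 2) * (-lam1 / 2) / (θ * (4 * θ ^ 2 + (θ - 1) - 4 * θ ^ 2)) =
        2 * θ * -lam1 := by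
      rw [add_sub_cancel_left]
      field_simp
      ring
    rw [h, hβ]
    nlinarith
end
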